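/- For every integer n ≥ 1 there is a constant C(n) > 0 with the following property. Let f : S^{4n−1} → S^{2n} be a smooth map whose 2n-dilation is at most D, let ω be a smooth 2n-form on S^{2n} with ∫_{S^{2n}} ω = 1, and let β be any smooth (2n−1)-form on S^{4n−1} with dβ = f*ω (such a primitive exists since f*ω is exact). Then |∫_{S^{4n−1}} β ∧ f*ω| ≤ C(n)·D². (This integral is the Hopf invariant of f, and is independent of the choices of ω and β.) -/

import Mathlib

/-!
Basic notions: the unit sphere `S^{d-1} ⊆ ℝ^d`, the norm `‖Λ^k A‖` of the induced map on
`k`-th exterior powers of a linear map between inner product spaces, and the `k`-dilation of a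
`C¹` map between unit spheres.  A (`C¹`) map from `S^{d₁-1}` to `S^{d₂-1}` is represented by a
(`C¹`) ambient map `F : ℝ^{d₁} → ℝ^{d₂}` mapping the unit sphere into the unit sphere; its
`k`-dilation only depends on the restriction of `F` to the sphere, since the derivative is
restricted to the tangent space of the sphere.
-/

open scoped RealInnerProductSpace
open Set

noncomputable section

abbrev EucA (d : ℕ) := EuclideanSpace ℝ (Fin d)

/-- The unit sphere `S^{d-1}` in `ℝ^d` (with the round metric induced from `ℝ^d`). -/
def usph (d : ℕ) : Set (EucA d) := Metric.sphere 0 1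

/-- The operator norm `‖Λ^k A‖` of the induced map on `k`-th exterior powers (with their induced
inner products): the supremum, over orthonormal `k`-frames `v` of the domain, of the `k`-volume
`√ det (⟪A vᵢ, A vⱼ⟫)` of the image frame `A v₁, …, A v_k`. -/
noncomputable def lamNorm {E F : Type*} [NormedAddCommGroup E] [InnerProductSpace ℝ E]
    [NormedAddCommGroup F] [InnerProductSpace ℝ F] (k : ℕ) (A : E →ₗ[ℝ] F) : ℝ :=
  ⨆ v : {v : Fin k → E // Orthonormal ℝ v},
    Real.sqrt (Matrix.of fun (i j : Fin k) => ⟪A (v.1 i), A (v.1 j)⟫).det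

/-- The `k`-dilation of a map of the unit sphere `S^{d-1}` into an inner product space (e.g. into
`ℝ^{d₂}`, for a map to the sphere `S^{d₂-1}`), the map being given by an ambient map `F`: the
supremum over points `x` of the sphere of `‖Λ^k df_x‖`, where `df_x` is the derivative of `F` at
`x` restricted to the tangent space `(ℝ∙x)ᗮ` of the sphere at `x`. -/
noncomputable def kDilation {d : ℕ} {F' : Type*} [NormedAddCommGroup F']
    [InnerProductSpace ℝ F'] (k : ℕ) (F : EucA d → F') : ℝ :=
  ⨆ x : usph d,
    lamNorm k ((fderiv ℝ F (x : EucA d)).toLinearMap ∘ₗ ((ℝ ∙ (x : EucA d))ᗮ).subtype)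

open MeasureTheory

/-- Pointwise evaluation (on constant vector fields) of the exterior derivative of a `k`-form
`β` on `ℝ^d`: `dβ_x(v₀,…,v_k) = ∑ᵢ (-1)ⁱ ∂_{vᵢ}(y ↦ β_y(v₀,…,v̂ᵢ,…,v_k))(x)`. -/
noncomputable def extDEval {d k : ℕ} (β : EucA d → AlternatingMap ℝ (EucA d) ℝ (Fin k))
    (x : EucA d) (v : Fin (k + 1) → EucA d) : ℝ :=
  ∑ i : Fin (k + 1), (-1 : ℝ) ^ (i : ℕ) * fderiv ℝ (fun y => β y (v ∘ i.succAbove)) x (v i)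

/-- Pointwise evaluation of the pullback `F*ω` of a `k`-form `ω` under `F`:
`(F*ω)_x(v₁,…,v_k) = ω_{F x}(dF_x v₁, …, dF_x v_k)`. -/
noncomputable def pbEval {d₁ d₂ k : ℕ} (F : EucA d₁ → EucA d₂)
    (ω : EucA d₂ → AlternatingMap ℝ (EucA d₂) ℝ (Fin k))
    (x : EucA d₁) (v : Fin k → EucA d₁) : ℝ :=
  ω (F x) fun i => fderiv ℝ F x (v i)

/-- Pointwise evaluation of the wedge product `α ∧ β` of a `p`-form and a `q`-form:
`(α ∧ β)(v) = (p! q!)⁻¹ ∑_{σ ∈ S_{p+q}} sign σ · α(v_{σ(1)},…,v_{σ(p)}) β(v_{σ(p+1)},…)`. -/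
noncomputable def wedgeEval {E : Type*} (p q : ℕ) (α : (Fin p → E) → ℝ) (β : (Fin q → E) → ℝ)
    (v : Fin (p + q) → E) : ℝ :=
  ((p.factorial * q.factorial : ℕ) : ℝ)⁻¹ *
    ∑ σ : Equiv.Perm (Fin (p + q)), ((Equiv.Perm.sign σ : ℤ) : ℝ) *
      (α (fun i => v (σ (Fin.castAdd q i))) * β fun j => v (σ (Fin.natAdd p j)))

/-- Orthogonal projection of `v` onto the tangent space of the unit sphere at `x`. -/
noncomputable def tproj {d : ℕ} (x v : EucA d) : EucA d := v - ⟪v, x⟫ • x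

/-- The density at `x ∈ S^{d-1}` of a top-degree (`k = d-1`) form `α` with respect to the
Riemannian volume of the unit sphere with its standard orientation: the unique `c` with
`α|_{T_x} = c · vol_x`, `vol_x(v₁,…,v_k) = det(x, v₁, …, v_k)` (outward normal first) being the
Riemannian volume form; `c` is computed by pairing `α` with `vol_x`, using the Parseval tight
frame of the tangent space obtained by projecting the standard basis of `ℝ^d`. -/
noncomputable def sphDensity {d k : ℕ} (h : k + 1 = d) (α : (Fin k → EucA d) → ℝ)
    (x : EucA d) : ℝ :=
  ((k.factorial : ℕ) : ℝ)⁻¹ *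
    ∑ σ : Fin k → Fin d,
      α (fun i => tproj x (EuclideanSpace.single (σ i) 1)) *
        (Matrix.of fun (i j : Fin d) =>
          (Fin.cons x fun i' : Fin k => tproj x (EuclideanSpace.single (σ i') 1) :
            Fin (k + 1) → EucA d) (Fin.cast h.symm i) j).det

/-- The integral `∫_{S^{d-1}} α` of a top-degree form over the unit sphere with its standard
orientation: the integral of its density with respect to the `(d-1)`-dimensional Hausdorff
(i.e. Riemannian surface) measure; `ρ = d - 1` is the dimension of the sphere. -/
noncomputable def sphereFormIntegral {d k : ℕ} (h : k + 1 = d) (ρ : ℝ)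
    (α : EucA d → (Fin k → EucA d) → ℝ) : ℝ :=
  ∫ x in usph d, sphDensity h (α x) x ∂μH[ρ]

set_option linter.unusedSectionVars false

section forms
variable {E G X : Type*} [NormedAddCommGroup E] [InnerProductSpace ℝ E] [FiniteDimensional ℝ E]
  [NormedAddCommGroup G] [InnerProductSpace ℝ G] [FiniteDimensional ℝ G]
  [NormedAddCommGroup X] [NormedSpace ℝ X]

/-- An alternating `k`-form vanishes on vectors orthogonal to a fixed nonzero vector as soon as
`k` is at least the dimension. -/
theorem alternatingMap_eq_zero_of_orthogonal {k : ℕ} (α : AlternatingMap ℝ E ℝ (Fin k)) {y : E}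
    (hy : y ≠ 0) (hk : Module.finrank ℝ E ≤ k) (v : Fin k → E) (hv : ∀ i, ⟪v i, y⟫ = 0) :
    α v = 0 := by
  apply α.map_linearDependent
  intro hli
  have hmem : ∀ i, v i ∈ (ℝ ∙ y)ᗮ := fun i => by
    rw [Submodule.mem_orthogonal_singleton_iff_inner_left]; exact hv i
  have hli' : LinearIndependent ℝ (fun i => (⟨v i, hmem i⟩ : (ℝ ∙ y)ᗮ)) := by
    apply LinearIndependent.of_comp (ℝ ∙ y)ᗮ.subtype
    exact hli
  have h1 := hli'.fintype_card_le_finrank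
  have h2 := (ℝ ∙ y).finrank_add_finrank_orthogonal
  rw [finrank_span_singleton hy] at h2
  simp at h1
  omega

theorem alternatingMap_eq_sum {k : ℕ} {ι : Type*} [Fintype ι] (e : OrthonormalBasis ι ℝ E)
    (α : AlternatingMap ℝ E ℝ (Fin k)) (v : Fin k → E) :
    α v = ∑ σ : Fin k → ι, (∏ i, ⟪e (σ i), v i⟫) * α (fun i => e (σ i)) := by
  classical
  conv_lhs => rw [show v = fun i => ∑ j, ⟪e j, v i⟫ • e j from
    funext fun i => (e.sum_repr' (v i)).symm]
  have := α.toMultilinearMap.map_sum (fun i j => ⟪e j, v i⟫ • e j)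
  simp only [AlternatingMap.coe_multilinearMap] at this
  rw [this]
  refine Finset.sum_congr rfl fun σ _ => ?_
  have := α.toMultilinearMap.map_smul_univ (fun i => ⟪e (σ i), v i⟫) (fun i => e (σ i))
  simpa using this

theorem norm_le_of_frame_le {k : ℕ} {ι : Type*} [Fintype ι] (e : OrthonormalBasis ι ℝ E)
    (α : E [⋀^Fin k]→L[ℝ] ℝ) {M : ℝ} (hM : 0 ≤ M)
    (h : ∀ σ : Fin k → ι, |α (fun i => e (σ i))| ≤ M) :
    ‖α‖ ≤ (Fintype.card ι : ℝ) ^ k * M := by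
  refine ContinuousAlternatingMap.opNorm_le_bound _ (by positivity) fun v => ?_
  have := alternatingMap_eq_sum e α.toAlternatingMap v
  simp only [ContinuousAlternatingMap.coe_toAlternatingMap] at this
  rw [this]
  refine (norm_sum_le _ _).trans ?_
  calc ∑ σ : Fin k → ι, ‖(∏ i, ⟪e (σ i), v i⟫) * α (fun i => e (σ i))‖
      ≤ ∑ σ : Fin k → ι, (∏ i, ‖v i‖) * M := by
        refine Finset.sum_le_sum fun σ _ => ?_
        rw [norm_mul, norm_prod]
        refine mul_le_mul (Finset.prod_le_prod (fun _ _ => norm_nonneg _) fun i _ => ?_) (h σ)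
          (norm_nonneg _) (Finset.prod_nonneg fun _ _ => norm_nonneg _)
        refine (norm_inner_le_norm _ _).trans ?_
        simp
    _ = _ := by
        simp [Finset.sum_const, Finset.card_univ]; ring

/-- In finite dimensions every alternating map is continuous; as a linear map. -/
def toCAM (k : ℕ) : AlternatingMap ℝ E ℝ (Fin k) →ₗ[ℝ] E [⋀^Fin k]→L[ℝ] ℝ where
  toFun α := { α with
    cont := by
      have : (α : (Fin k → E) → ℝ) = fun v => ∑ σ : Fin k → Fin (Module.finrank ℝ E),
          (∏ i, ⟪stdOrthonormalBasis ℝ E (σ i), v i⟫) *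
            α (fun i => stdOrthonormalBasis ℝ E (σ i)) :=
        funext fun v => alternatingMap_eq_sum _ α v
      change Continuous (α : (Fin k → E) → ℝ)
      rw [this]; fun_prop }
  map_add' _ _ := rfl
  map_smul' _ _ := rfl

@[simp] theorem toCAM_apply {k : ℕ} (α : AlternatingMap ℝ E ℝ (Fin k)) (v : Fin k → E) :
    toCAM k α v = α v := rfl

theorem exists_toCAM_section (k : ℕ) : ∃ L : ((Fin k → Fin (Module.finrank ℝ E)) → ℝ) →L[ℝ]
    (E [⋀^Fin k]→L[ℝ] ℝ), ∀ α : AlternatingMap ℝ E ℝ (Fin k),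
      L (fun σ => α fun i => stdOrthonormalBasis ℝ E (σ i)) = toCAM k α := by
  let ev : AlternatingMap ℝ E ℝ (Fin k) →ₗ[ℝ] ((Fin k → Fin (Module.finrank ℝ E)) → ℝ) :=
    { toFun := fun α σ => α fun i => stdOrthonormalBasis ℝ E (σ i)
      map_add' := fun _ _ => rfl
      map_smul' := fun _ _ => rfl }
  have hinj : LinearMap.ker ev = ⊥ := by
    rw [LinearMap.ker_eq_bot']
    intro α hα
    ext v
    rw [alternatingMap_eq_sum (stdOrthonormalBasis ℝ E) α v]
    refine Finset.sum_eq_zero fun σ _ => ?_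
    have : ev α σ = 0 := by rw [hα]; rfl
    simp only [ev, LinearMap.coe_mk, AddHom.coe_mk] at this
    rw [this, mul_zero]
  obtain ⟨g, hg⟩ := LinearMap.exists_leftInverse_of_injective ev hinj
  refine ⟨((toCAM k) ∘ₗ g).toContinuousLinearMap, fun α => ?_⟩
  have := LinearMap.congr_fun hg α
  simp only [LinearMap.comp_apply, LinearMap.id_apply] at this
  change toCAM k (g (ev α)) = _
  rw [this]

theorem contDiff_toCAM {k : ℕ} {n : WithTop ℕ∞} {f : X → AlternatingMap ℝ E ℝ (Fin k)}
    (hf : ∀ v, ContDiff ℝ n fun x => f x v) : ContDiff ℝ n fun x => toCAM k (f x) := by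
  obtain ⟨L, hL⟩ := exists_toCAM_section (E := E) k
  simp_rw [← hL]
  exact L.contDiff.comp (contDiff_pi.2 fun σ => hf _)

theorem contDiff_cam {k : ℕ} {n : WithTop ℕ∞} {f : X → E [⋀^Fin k]→L[ℝ] ℝ}
    (hf : ∀ v, ContDiff ℝ n fun x => f x v) : ContDiff ℝ n f :=
  contDiff_toCAM (f := fun x => (f x).toAlternatingMap) hf

theorem ContDiff.cam_apply {k : ℕ} {n : WithTop ℕ∞} {f : X → E [⋀^Fin k]→L[ℝ] ℝ}
    {v : X → Fin k → E} (hf : ContDiff ℝ n f) (hv : ∀ i, ContDiff ℝ n fun x => v x i) :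
    ContDiff ℝ n fun x => f x (v x) := by
  have : (fun x => f x (v x)) = fun x => ∑ σ : Fin k → Fin (Module.finrank ℝ E),
      (∏ i, ⟪stdOrthonormalBasis ℝ E (σ i), v x i⟫) *
            f x (fun i => stdOrthonormalBasis ℝ E (σ i)) :=
        funext fun x => alternatingMap_eq_sum _ (f x).toAlternatingMap (v x)
  rw [this]
  refine ContDiff.sum fun σ _ => ContDiff.mul (contDiff_prod fun i _ => ?_) ?_
  · exact contDiff_const.inner ℝ (hv i)
  · exact (ContinuousLinearMap.contDiff
      (ContinuousAlternatingMap.apply ℝ E ℝ (fun i => stdOrthonormalBasis ℝ E (σ i)))).comp hf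

/-- Pullback of a differential form. -/
def pb {k : ℕ} (h : E → G) (ω : G → G [⋀^Fin k]→L[ℝ] ℝ) (y : E) : E [⋀^Fin k]→L[ℝ] ℝ :=
  (ω (h y)).compContinuousLinearMap (fderiv ℝ h y)

theorem pb_apply {k : ℕ} (h : E → G) (ω : G → G [⋀^Fin k]→L[ℝ] ℝ) (y : E) (v : Fin k → E) :
    pb h ω y v = ω (h y) (fun i => fderiv ℝ h y (v i)) := rfl

theorem contDiff_pb {k : ℕ} {h : E → G} {ω : G → G [⋀^Fin k]→L[ℝ] ℝ}
    (hh : ContDiff ℝ (⊤ : ℕ∞) h) (hω : ContDiff ℝ (⊤ : ℕ∞) ω) :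
    ContDiff ℝ (⊤ : ℕ∞) (pb h ω) := by
  refine contDiff_cam fun v => ?_
  simp only [pb_apply]
  refine ContDiff.cam_apply (hω.comp hh) fun i => ?_
  exact (hh.fderiv_right (m := (⊤ : ℕ∞)) (by simp)).clm_apply contDiff_const

theorem norm_pb_le {k : ℕ} (h : E → G) (ω : G → G [⋀^Fin k]→L[ℝ] ℝ) (y : E) :
    ‖pb h ω y‖ ≤ ‖ω (h y)‖ * ‖fderiv ℝ h y‖ ^ k := by
  refine ContinuousAlternatingMap.opNorm_le_bound _ (by positivity) fun v => ?_
  rw [pb_apply]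
  refine ((ω (h y)).le_opNorm _).trans ?_
  rw [mul_assoc]
  gcongr
  calc ∏ i, ‖fderiv ℝ h y (v i)‖ ≤ ∏ i, ‖fderiv ℝ h y‖ * ‖v i‖ :=
        Finset.prod_le_prod (fun _ _ => norm_nonneg _) fun i _ => (fderiv ℝ h y).le_opNorm _
    _ = _ := by rw [Finset.prod_mul_distrib]; simp

theorem extDeriv_pb {k : ℕ} {h : E → G} {ω : G → G [⋀^Fin k]→L[ℝ] ℝ}
    (hh : ContDiff ℝ (⊤ : ℕ∞) h) (hω : ContDiff ℝ (⊤ : ℕ∞) ω) (y : E) :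
    extDeriv (pb h ω) y = pb h (extDeriv ω) y :=
  extDeriv_pullback (r := (⊤ : ℕ∞)) (hω.differentiable (by simp) _) hh.contDiffAt (by
    simp [minSmoothness_of_isRCLikeNormedField]; exact WithTop.coe_le_coe.2 le_top)

theorem extDeriv_apply_eq {k : ℕ} {ω : E → E [⋀^Fin k]→L[ℝ] ℝ} {x : E}
    (hω : DifferentiableAt ℝ ω x) (v : Fin (k + 1) → E) :
    extDeriv ω x v = ∑ i : Fin (k + 1), (-1 : ℝ) ^ (i : ℕ) *
      fderiv ℝ ω x (v i) (v ∘ i.succAbove) := by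
  rw [extDeriv_apply hω]
  refine Finset.sum_congr rfl fun i _ => ?_
  rw [fderiv_continuousAlternatingMap_apply_const_apply hω]
  simp only [zsmul_eq_mul, Int.cast_pow, Int.cast_neg, Int.cast_one]
  rfl

end forms

section altSum
variable {I J E : Type*} [Fintype I] [DecidableEq I] [Fintype J] [DecidableEq J]

/-- The alternating sum of a function of `I`-indexed families over all permutations. -/
def altSum (M : (I → E) → ℝ) (v : I → E) : ℝ :=
  ∑ σ : Equiv.Perm I, ((Equiv.Perm.sign σ : ℤ) : ℝ) * M (v ∘ σ)

theorem altSum_reindex (κ θ : I ≃ J) : ∃ ε : ℝ, |ε| = 1 ∧ ∀ (M : (I → E) → ℝ) (v : J → E),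
    altSum (fun w => M (w ∘ θ)) v = ε * altSum M (v ∘ κ) := by
  refine ⟨((Equiv.Perm.sign (κ.symm.trans θ) : ℤ) : ℝ), ?_, fun M v => ?_⟩
  · rcases Int.units_eq_one_or (Equiv.Perm.sign (κ.symm.trans θ)) with h | h <;> rw [h] <;> simp
  · unfold altSum
    rw [Finset.mul_sum]
    let Ψ : Equiv.Perm J ≃ Equiv.Perm I :=
      { toFun := fun σ => (θ.trans σ).trans κ.symm
        invFun := fun τ => (θ.symm.trans τ).trans κ
        left_inv := fun σ => by ext; simp
        right_inv := fun σ => by ext; simp }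
    rw [← Equiv.sum_comp Ψ]
    refine Finset.sum_congr rfl fun σ _ => ?_
    have h1 : σ = (κ.permCongr (Ψ σ)) * (κ.symm.trans θ)⁻¹ := by
      ext x; simp [Ψ, Equiv.permCongr_apply, Equiv.Perm.inv_def]
    have h2 : Equiv.Perm.sign σ = Equiv.Perm.sign (κ.symm.trans θ) * Equiv.Perm.sign (Ψ σ) := by
      conv_lhs => rw [h1]
      rw [Equiv.Perm.sign_mul, Equiv.Perm.sign_permCongr, Equiv.Perm.sign_inv, mul_comm]
    have h3 : (v ∘ κ) ∘ (Ψ σ) = (v ∘ σ) ∘ θ := by ext; simp [Ψ]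
    rw [h3, h2]
    push_cast; ring

theorem altSum_precomp (τ : Equiv.Perm I) (M : (I → E) → ℝ) (v : I → E) :
    altSum (fun w => M (w ∘ τ)) v = ((Equiv.Perm.sign τ : ℤ) : ℝ) * altSum M v := by
  unfold altSum
  rw [Finset.mul_sum, ← Equiv.sum_comp (Equiv.mulRight τ⁻¹)]
  refine Finset.sum_congr rfl fun σ _ => ?_
  have : (v ∘ ⇑(σ * τ⁻¹)) ∘ ⇑τ = v ∘ σ := by ext; simp
  simp only [Equiv.coe_mulRight, Equiv.Perm.sign_mul, Equiv.Perm.sign_inv, this]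
  push_cast; ring

theorem abs_altSum_le {M : (I → E) → ℝ} {v : I → E} {C : ℝ}
    (h : ∀ σ : Equiv.Perm I, |M (v ∘ σ)| ≤ C) :
    |altSum M v| ≤ (Fintype.card I).factorial * C := by
  unfold altSum
  refine (Finset.abs_sum_le_sum_abs _ _).trans ?_
  refine (Finset.sum_le_card_nsmul _ _ C fun σ _ => ?_).trans ?_
  · rw [abs_mul]
    have : |((Equiv.Perm.sign σ : ℤ) : ℝ)| = 1 := by
      rcases Int.units_eq_one_or (Equiv.Perm.sign σ) with h | h <;> rw [h] <;> simp
    rw [this, one_mul]; exact h σ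
  · simp [Finset.card_univ, Fintype.card_perm]

theorem altSum_add (M M' : (I → E) → ℝ) (v : I → E) :
    altSum (fun w => M w + M' w) v = altSum M v + altSum M' v := by
  simp [altSum, mul_add, Finset.sum_add_distrib]

theorem altSum_sum {K : Type*} (s : Finset K) (M : K → (I → E) → ℝ) (v : I → E) :
    altSum (fun w => ∑ i ∈ s, M i w) v = ∑ i ∈ s, altSum (M i) v := by
  simp only [altSum, Finset.mul_sum]
  rw [Finset.sum_comm]

theorem altSum_const_mul (c : ℝ) (M : (I → E) → ℝ) (v : I → E) :
    altSum (fun w => c * M w) v = c * altSum M v := by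
  simp only [altSum, Finset.mul_sum]
  exact Finset.sum_congr rfl fun _ _ => by ring

end altSum

section wedge
variable {E G : Type*} [NormedAddCommGroup E] [InnerProductSpace ℝ E]
  [NormedAddCommGroup G] [InnerProductSpace ℝ G]

theorem wedgeEval_eq_altSum (p q : ℕ) (α : (Fin p → E) → ℝ) (β : (Fin q → E) → ℝ)
    (v : Fin (p + q) → E) : wedgeEval p q α β v = ((p.factorial * q.factorial : ℕ) : ℝ)⁻¹ *
      altSum (fun w => α (w ∘ Fin.castAdd q) * β (w ∘ Fin.natAdd p)) v := rfl

theorem wedgeEval_comm (p q : ℕ) (hpq : q + p = p + q) : ∃ ε : ℝ, |ε| = 1 ∧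
    ∀ (α : (Fin p → E) → ℝ) (β : (Fin q → E) → ℝ) (v : Fin (p + q) → E),
    wedgeEval p q α β v = ε * wedgeEval q p β α (v ∘ Fin.cast hpq) := by
  obtain ⟨ε, hε, h⟩ := altSum_reindex (E := E) (finCongr hpq) (finAddFlip (m := q) (n := p))
  refine ⟨ε, hε, fun α β v => ?_⟩
  have := h (fun w => β (w ∘ Fin.castAdd p) * α (w ∘ Fin.natAdd q)) v
  rw [wedgeEval_eq_altSum, wedgeEval_eq_altSum]
  have h2 : (fun w : Fin (p + q) → E => α (w ∘ Fin.castAdd q) * β (w ∘ Fin.natAdd p)) =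
      fun w => β ((w ∘ finAddFlip) ∘ Fin.castAdd p) * α ((w ∘ finAddFlip) ∘ Fin.natAdd q) := by
    ext w
    rw [mul_comm]
    congr 2
    · ext j; simp
    · ext j; simp
  rw [h2, this, mul_comm p.factorial, mul_left_comm]
  rfl

theorem abs_wedgeEval_le (p q : ℕ) (α : E [⋀^Fin p]→L[ℝ] ℝ) (β : E [⋀^Fin q]→L[ℝ] ℝ)
    {v : Fin (p + q) → E} (hv : ∀ i, ‖v i‖ ≤ 1) :
    |wedgeEval p q α β v| ≤ (p + q).factorial * (‖α‖ * ‖β‖) := by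
  rw [wedgeEval_eq_altSum, abs_mul]
  have h1 : ∀ {k : ℕ} (γ : E [⋀^Fin k]→L[ℝ] ℝ) (w : Fin k → E), (∀ i, ‖w i‖ ≤ 1) →
      |γ w| ≤ ‖γ‖ := fun γ w hw => by
    refine (γ.le_opNorm w).trans ?_
    refine mul_le_of_le_one_right (norm_nonneg _) ?_
    exact Finset.prod_le_one (fun _ _ => norm_nonneg _) fun i _ => hw i
  have h2 := abs_altSum_le (M := fun w : Fin (p + q) → E =>
    α (w ∘ Fin.castAdd q) * β (w ∘ Fin.natAdd p)) (v := v) (C := ‖α‖ * ‖β‖) (fun σ => by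
      rw [abs_mul]
      exact mul_le_mul (h1 _ _ fun _ => hv _) (h1 _ _ fun _ => hv _) (abs_nonneg _)
        (norm_nonneg _))
  rw [Fintype.card_fin] at h2
  have h3 : |((p.factorial * q.factorial : ℕ) : ℝ)⁻¹| ≤ 1 := by
    rw [abs_of_nonneg (by positivity)]
    apply inv_le_one_of_one_le₀
    exact_mod_cast Nat.mul_pos p.factorial_pos q.factorial_pos
  exact (mul_le_mul h3 h2 (abs_nonneg _) zero_le_one).trans (one_mul _).le

/-- The wedge product of two alternating maps. -/
def wedgeAlt (p q : ℕ) (α : AlternatingMap ℝ E ℝ (Fin p)) (β : AlternatingMap ℝ E ℝ (Fin q)) :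
    AlternatingMap ℝ E ℝ (Fin (p + q)) :=
  ((p.factorial * q.factorial : ℕ) : ℝ)⁻¹ • MultilinearMap.alternatization
    (((LinearMap.mul' ℝ ℝ).compMultilinearMap
      (MultilinearMap.domCoprod α.toMultilinearMap β.toMultilinearMap)).domDomCongr
        finSumFinEquiv)

theorem wedgeAlt_apply (p q : ℕ) (α : AlternatingMap ℝ E ℝ (Fin p))
    (β : AlternatingMap ℝ E ℝ (Fin q)) (v : Fin (p + q) → E) :
    wedgeAlt p q α β v = wedgeEval p q α β v := by
  simp only [wedgeAlt, AlternatingMap.smul_apply, MultilinearMap.alternatization_apply,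
    wedgeEval, smul_eq_mul]
  congr 1
  refine Finset.sum_congr rfl fun σ _ => ?_
  rw [Units.smul_def, zsmul_eq_mul]
  simp [MultilinearMap.domCoprod_apply]

theorem wedgeEval_smul_right (p q : ℕ) (α : (Fin p → E) → ℝ) (β : (Fin q → E) → ℝ) (c : ℝ)
    (v : Fin (p + q) → E) :
    wedgeEval p q α (fun w => c * β w) v = c * wedgeEval p q α β v := by
  rw [wedgeEval_eq_altSum, wedgeEval_eq_altSum]
  have : (fun w : Fin (p + q) → E => α (w ∘ Fin.castAdd q) * (c * β (w ∘ Fin.natAdd p))) =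
    fun w => c * (α (w ∘ Fin.castAdd q) * β (w ∘ Fin.natAdd p)) := by ext; ring
  rw [this, altSum_const_mul]; ring

theorem wedgeEval_comp (p q : ℕ) (α : (Fin p → G) → ℝ) (β : (Fin q → G) → ℝ) (L : E → G)
    (v : Fin (p + q) → E) :
    wedgeEval p q (fun w => α fun i => L (w i)) (fun w => β fun i => L (w i)) v =
      wedgeEval p q α β fun i => L (v i) := rfl

end wedge

section stokesAlg
variable {E : Type*} [NormedAddCommGroup E] [InnerProductSpace ℝ E] [FiniteDimensional ℝ E]

theorem wedgeEval_extDeriv_left {p q : ℕ} {γ : E → E [⋀^Fin p]→L[ℝ] ℝ} {x : E}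
    (hγ : DifferentiableAt ℝ γ x) (δ : (Fin q → E) → ℝ) (v : Fin (p + 1 + q) → E) :
    wedgeEval (p + 1) q (extDeriv γ x) δ v =
      (((p + 1).factorial * q.factorial : ℕ) : ℝ)⁻¹ * (p + 1) *
        altSum (fun w => fderiv ℝ γ x (w (Fin.castAdd q 0)) (w ∘ Fin.castAdd q ∘ Fin.succ) *
          δ (w ∘ Fin.natAdd (p + 1))) v := by
  rw [wedgeEval_eq_altSum, mul_assoc]
  congr 1
  let M : (Fin (p + 1 + q) → E) → ℝ := fun w =>
    fderiv ℝ γ x (w (Fin.castAdd q 0)) (w ∘ Fin.castAdd q ∘ Fin.succ) *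
          δ (w ∘ Fin.natAdd (p + 1))
  let τ : Fin (p + 1) → Equiv.Perm (Fin (p + 1 + q)) := fun i =>
    finSumFinEquiv.permCongr (Equiv.Perm.sumCongr i.cycleRange.symm 1)
  have hτ : ∀ i, ((Equiv.Perm.sign (τ i) : ℤ) : ℝ) = (-1) ^ (i : ℕ) := fun i => by
    simp only [τ, Equiv.Perm.sign_permCongr, Equiv.Perm.sign_sumCongr, Equiv.Perm.sign_symm,
      Fin.sign_cycleRange]
    simp
  have h1 : (fun w : Fin (p + 1 + q) → E =>
      extDeriv γ x (w ∘ Fin.castAdd q) * δ (w ∘ Fin.natAdd (p + 1))) =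
      fun w => ∑ i : Fin (p + 1), (-1 : ℝ) ^ (i : ℕ) * M (w ∘ τ i) := by
    ext w
    rw [extDeriv_apply_eq hγ, Finset.sum_mul]
    refine Finset.sum_congr rfl fun i _ => ?_
    simp only [M]
    rw [mul_assoc]
    congr 3
    · simp [τ, Equiv.permCongr_apply]
    · ext j; simp [τ, Equiv.permCongr_apply]
    · ext j; simp [τ, Equiv.permCongr_apply]
  rw [h1, altSum_sum]
  simp_rw [altSum_const_mul, altSum_precomp, hτ, ← mul_assoc, ← pow_add, ← two_mul]
  simp [M]

/-- The permutation of slots exchanging the two blocks behind the first slot. -/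
def slotEquiv (p q : ℕ) : Fin (q + 1 + p) ≃ Fin (p + 1 + q) where
  toFun := Fin.addCases (Fin.cases (Fin.castAdd q 0) (Fin.natAdd (p + 1)))
    fun i => Fin.castAdd q i.succ
  invFun := Fin.addCases (Fin.cases (Fin.castAdd p 0) (Fin.natAdd (q + 1)))
    fun i => Fin.castAdd p i.succ
  left_inv := by
    refine Fin.addCases (Fin.cases ?_ fun i => ?_) fun i => ?_ <;> simp
  right_inv := by
    refine Fin.addCases (Fin.cases ?_ fun i => ?_) fun i => ?_ <;> simp

theorem wedgeEval_extDeriv_right (p q : ℕ) : ∃ c : ℝ, c ≠ 0 ∧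
    ∀ {δ : E → E [⋀^Fin q]→L[ℝ] ℝ} {x : E} (_ : DifferentiableAt ℝ δ x)
      (γ : (Fin p → E) → ℝ) (v : Fin (p + 1 + q) → E),
    wedgeEval p (q + 1) γ (extDeriv δ x) (v ∘ Fin.cast (by omega)) =
      c * altSum (fun w => γ (w ∘ Fin.castAdd q ∘ Fin.succ) *
        fderiv ℝ δ x (w (Fin.castAdd q 0)) (w ∘ Fin.natAdd (p + 1))) v := by
  obtain ⟨ε, hε, h⟩ := wedgeEval_comm (E := E) p (q + 1) (by omega)
  obtain ⟨ε', hε', h'⟩ := altSum_reindex (E := E)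
    (finCongr (by omega : q + 1 + p = p + 1 + q)) (slotEquiv p q)
  have hε0 : ε ≠ 0 := fun h0 => by simp [h0] at hε
  have hε0' : ε' ≠ 0 := fun h0 => by simp [h0] at hε'
  refine ⟨ε * ((((q + 1).factorial * p.factorial : ℕ) : ℝ)⁻¹ * (q + 1)) * ε'⁻¹, ?_, ?_⟩
  · have : (((q + 1).factorial * p.factorial : ℕ) : ℝ) ≠ 0 := by
      exact_mod_cast (Nat.mul_pos (Nat.factorial_pos _) (Nat.factorial_pos _)).ne'
    have h2 : (q : ℝ) + 1 ≠ 0 := by positivity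
    positivity
  · intro δ x hδ γ v
    rw [h, wedgeEval_extDeriv_left hδ]
    have := h' (fun w => fderiv ℝ δ x (w (Fin.castAdd p 0)) (w ∘ Fin.castAdd p ∘ Fin.succ) *
          γ (w ∘ Fin.natAdd (q + 1))) v
    have h2 : (fun w : Fin (p + 1 + q) → E => γ (w ∘ Fin.castAdd q ∘ Fin.succ) *
        fderiv ℝ δ x (w (Fin.castAdd q 0)) (w ∘ Fin.natAdd (p + 1))) = fun w =>
        fderiv ℝ δ x ((w ∘ slotEquiv p q) (Fin.castAdd p 0))
          ((w ∘ slotEquiv p q) ∘ Fin.castAdd p ∘ Fin.succ) *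
          γ ((w ∘ slotEquiv p q) ∘ Fin.natAdd (q + 1)) := by
      ext w
      rw [mul_comm]
      congr 2
      · ext j; simp [slotEquiv]
      · ext j; simp [slotEquiv]
    rw [h2, this]
    rw [mul_assoc (ε * _), ← mul_assoc ε'⁻¹, inv_mul_cancel₀ hε0', one_mul, mul_assoc ε]
    rfl

end stokesAlg

section stokes
variable {E : Type*} [NormedAddCommGroup E] [InnerProductSpace ℝ E] [FiniteDimensional ℝ E]
  [MeasurableSpace E] [BorelSpace E]

theorem integral_fderiv_eq_zero_of_hasCompactSupport {f : E → ℝ} (hf : ContDiff ℝ 1 f)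
    (hc : HasCompactSupport f) (v : E) : ∫ x, fderiv ℝ f x v = 0 := by
  have hcont : Continuous fun x => fderiv ℝ f x v :=
    (hf.continuous_fderiv (by simp)).clm_apply continuous_const
  have hsupp : HasCompactSupport fun x => fderiv ℝ f x v := hc.fderiv_apply ℝ v
  have h := integral_mul_fderiv_eq_neg_fderiv_mul_of_integrable (μ := (volume : Measure E))
    (f := fun _ => (1 : ℝ)) (g := f) (v := v) (by simp)
    (by simpa using hcont.integrable_of_hasCompactSupport hsupp)
    (by simpa using hf.continuous.integrable_of_hasCompactSupport hc)
    (by simp) (fun x _ => hf.differentiable (by simp) x)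
  simpa using h

theorem exists_cutoff : ∃ (χ : ℕ → E → ℝ) (K : ℝ), 0 ≤ K ∧
    (∀ n, ContDiff ℝ 1 (χ n)) ∧ (∀ n, HasCompactSupport (χ n)) ∧ (∀ n x, |χ n x| ≤ 1) ∧
    (∀ x, Filter.Tendsto (fun n => χ n x) Filter.atTop (nhds 1)) ∧
    (∀ n x, ‖fderiv ℝ (χ n) x‖ ≤ K * (1 + ‖x‖)⁻¹) ∧
    (∀ x, Filter.Tendsto (fun n => fderiv ℝ (χ n) x) Filter.atTop (nhds 0)) := by
  let ψ : ContDiffBump (0 : E) := ⟨1, 2, one_pos, one_lt_two⟩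
  have hψ : ContDiff ℝ 1 ψ := ψ.contDiff
  have hdc : Continuous (fderiv ℝ ψ) := hψ.continuous_fderiv (by simp)
  obtain ⟨K, hK⟩ := hdc.norm.bounded_above_of_compact_support (ψ.hasCompactSupport.fderiv ℝ).norm
  simp only [norm_norm] at hK
  have hK0 : 0 ≤ K := (norm_nonneg _).trans (hK 0)
  have hfd : ∀ (n : ℕ) (x : E), fderiv ℝ (fun x => ψ (((n : ℝ) + 1)⁻¹ • x)) x =
      ((n : ℝ) + 1)⁻¹ • fderiv ℝ ψ (((n : ℝ) + 1)⁻¹ • x) := fun n x => by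
    exact fderiv_comp_smul (𝕜 := ℝ) (f := ψ) _
  have hbd : ∀ (n : ℕ) (x : E), ‖fderiv ℝ (fun x => ψ (((n : ℝ) + 1)⁻¹ • x)) x‖ ≤
      ((n : ℝ) + 1)⁻¹ * K := fun n x => by
    rw [hfd, norm_smul, norm_inv, Real.norm_of_nonneg (by positivity)]
    gcongr; exact hK _
  refine ⟨fun n x => ψ (((n : ℝ) + 1)⁻¹ • x), 3 * K, by positivity, fun n => ?_, fun n => ?_,
    fun n x => ?_, fun x => ?_, fun n x => ?_, fun x => ?_⟩
  · exact hψ.comp (contDiff_const_smul _)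
  · exact ψ.hasCompactSupport.comp_smul (by positivity)
  · rw [abs_of_nonneg ψ.nonneg]; exact ψ.le_one
  · refine tendsto_const_nhds.congr' ?_
    obtain ⟨k, hk⟩ := exists_nat_gt ‖x‖
    filter_upwards [Filter.eventually_ge_atTop k] with n hn
    refine (ψ.one_of_mem_closedBall ?_).symm
    rw [mem_closedBall_zero_iff, norm_smul, norm_inv, Real.norm_of_nonneg (by positivity)]
    have : (k : ℝ) ≤ n := by exact_mod_cast hn
    change _ ≤ (1 : ℝ)
    rw [inv_mul_le_iff₀ (by positivity)]; linarith
  · by_cases hx : ‖x‖ ≤ 2 * (n + 1)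
    · refine (hbd n x).trans ?_
      rw [mul_comm, mul_comm 3 K, mul_assoc]
      refine mul_le_mul_of_nonneg_left ?_ hK0
      rw [← div_eq_mul_inv, inv_eq_one_div, div_le_div_iff₀ (by positivity) (by positivity)]
      have : (0 : ℝ) ≤ n := by positivity
      linarith
    · have : fderiv ℝ ψ (((n : ℝ) + 1)⁻¹ • x) = 0 := by
        apply image_eq_zero_of_notMem_tsupport
        intro hmem
        have h2 := tsupport_fderiv_subset ℝ hmem
        rw [ψ.tsupport_eq, mem_closedBall_zero_iff, norm_smul, norm_inv,
          Real.norm_of_nonneg (by positivity), inv_mul_le_iff₀ (by positivity)] at h2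
        change _ ≤ _ * (2 : ℝ) at h2
        linarith
      rw [hfd, this]; simp; positivity
  · rw [tendsto_zero_iff_norm_tendsto_zero]
    refine squeeze_zero (fun _ => norm_nonneg _) (fun n => hbd n x) ?_
    have := (tendsto_one_div_add_atTop_nhds_zero_nat (𝕜 := ℝ)).mul_const K
    simpa using this

/-- Sum of the integrals of derivatives along fixed directions of `C¹` functions with critical
decay, organised by a finite family. -/
theorem integral_sum_fderiv_eq_zero {ι : Type*} [Fintype ι] (P : ι → E → ℝ) (v : ι → E)
    (hP : ∀ i, ContDiff ℝ 1 (P i)) (C : ℝ)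
    (hdec : ∀ i x, |P i x| ≤ C * (1 + ‖x‖) ^ (-(Module.finrank ℝ E : ℝ)))
    (hint : Integrable fun x => ∑ i, fderiv ℝ (P i) x (v i)) :
    ∫ x, ∑ i, fderiv ℝ (P i) x (v i) = 0 := by
  obtain ⟨χ, K, hK, h1, h2, h3, h4, h5, h6⟩ := exists_cutoff (E := E)
  have hC : 0 ≤ C ∨ IsEmpty ι := by
    rcases isEmpty_or_nonempty ι with h | ⟨⟨i⟩⟩
    · exact Or.inr h
    · left
      have := (abs_nonneg _).trans (hdec i 0)
      simpa using this
  rcases hC with hC | h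
  swap
  · simp
  have hPc : ∀ i, Continuous fun x => fderiv ℝ (P i) x (v i) := fun i =>
    ((hP i).continuous_fderiv (by simp)).clm_apply continuous_const
  have hχc : ∀ n i, Continuous fun x => fderiv ℝ (χ n) x (v i) := fun n i =>
    ((h1 n).continuous_fderiv (by simp)).clm_apply continuous_const
  have hzero : ∀ n, ∫ x, (χ n x * ∑ i, fderiv ℝ (P i) x (v i)) +
      ∑ i, fderiv ℝ (χ n) x (v i) * P i x = 0 := fun n => by
    have e1 : (fun x => (χ n x * ∑ i, fderiv ℝ (P i) x (v i)) +
      ∑ i, fderiv ℝ (χ n) x (v i) * P i x) = fun x => ∑ i,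
        fderiv ℝ (fun y => χ n y * P i y) x (v i) := by
      ext x
      rw [Finset.mul_sum, ← Finset.sum_add_distrib]
      refine Finset.sum_congr rfl fun i _ => ?_
      rw [fderiv_fun_mul ((h1 n).differentiable (by simp) x) ((hP i).differentiable (by simp) x)]
      simp; ring
    have hcd : ∀ i, ContDiff ℝ 1 fun y => χ n y * P i y := fun i => (h1 n).mul (hP i)
    have hcs : ∀ i, HasCompactSupport fun y => χ n y * P i y := fun i => (h2 n).mul_right
    rw [e1, integral_finsetSum]
    · exact Finset.sum_eq_zero fun i _ =>
        integral_fderiv_eq_zero_of_hasCompactSupport (hcd i) (hcs i) _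
    · intro i _
      exact (((hcd i).continuous_fderiv (by simp)).clm_apply
        continuous_const).integrable_of_hasCompactSupport ((hcs i).fderiv_apply ℝ (v i))
  have hdom : Integrable fun x : E => |∑ i, fderiv ℝ (P i) x (v i)| +
      (∑ i, K * ‖v i‖ * C) * (1 + ‖x‖) ^ (-((Module.finrank ℝ E : ℝ) + 1)) :=
    hint.norm.add ((integrable_one_add_norm (by linarith)).const_mul _)
  have hlim := tendsto_integral_of_dominated_convergence
    (F := fun n x => (χ n x * ∑ i, fderiv ℝ (P i) x (v i)) +
      ∑ i, fderiv ℝ (χ n) x (v i) * P i x) (f := fun x => ∑ i, fderiv ℝ (P i) x (v i))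
    (μ := volume) _ (fun n => ?_) hdom (fun n => Filter.Eventually.of_forall fun x => ?_)
    (Filter.Eventually.of_forall fun x => ?_)
  · simp_rw [hzero] at hlim
    exact (tendsto_nhds_unique hlim tendsto_const_nhds)
  · refine Continuous.aestronglyMeasurable (Continuous.add ((h1 n).continuous.mul
      (continuous_finsetSum _ fun i _ => hPc i)) (continuous_finsetSum _ fun i _ =>
        (hχc n i).mul (hP i).continuous))
  · refine (norm_add_le _ _).trans (add_le_add ?_ ?_)
    · rw [Real.norm_eq_abs, abs_mul]
      exact mul_le_of_le_one_left (abs_nonneg _) (h3 n x)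
    · rw [Finset.sum_mul]
      refine (norm_sum_le _ _).trans (Finset.sum_le_sum fun i _ => ?_)
      rw [norm_mul]
      have hx : (0 : ℝ) < 1 + ‖x‖ := by positivity
      have h7 : ‖fderiv ℝ (χ n) x (v i)‖ ≤ K * (1 + ‖x‖)⁻¹ * ‖v i‖ :=
        ((fderiv ℝ (χ n) x).le_opNorm _).trans (by gcongr; exact h5 n x)
      calc _ ≤ (K * (1 + ‖x‖)⁻¹ * ‖v i‖) * (C * (1 + ‖x‖) ^ (-(Module.finrank ℝ E : ℝ))) :=
            mul_le_mul h7 (hdec i x) (abs_nonneg _) (by positivity)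
        _ = _ := by
            rw [neg_add, Real.rpow_add hx, Real.rpow_neg_one]; ring
  · have e1 : Filter.Tendsto (fun n => χ n x * ∑ i, fderiv ℝ (P i) x (v i)) Filter.atTop
        (nhds (1 * ∑ i, fderiv ℝ (P i) x (v i))) := (h4 x).mul_const _
    have e2 : Filter.Tendsto (fun n => ∑ i, fderiv ℝ (χ n) x (v i) * P i x) Filter.atTop
        (nhds (∑ i : ι, (0 : E →L[ℝ] ℝ) (v i) * P i x)) := by
      refine tendsto_finsetSum _ fun i _ => Filter.Tendsto.mul_const _ ?_
      exact ((ContinuousLinearMap.apply ℝ ℝ (v i)).continuous.tendsto _).comp (h6 x)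
    simpa using e1.add e2

theorem continuous_wedgeEval {p q : ℕ} {γ : E → E [⋀^Fin p]→L[ℝ] ℝ} {δ : E → E [⋀^Fin q]→L[ℝ] ℝ}
    (hγ : Continuous γ) (hδ : Continuous δ) (e : Fin (p + q) → E) :
    Continuous fun x => wedgeEval p q (γ x) (δ x) e := by
  unfold wedgeEval
  refine continuous_const.mul (continuous_finsetSum _ fun σ _ => continuous_const.mul
    (Continuous.mul ?_ ?_))
  · exact (ContinuousLinearMap.continuous (ContinuousAlternatingMap.apply ℝ E ℝ _)).comp hγ
  · exact (ContinuousLinearMap.continuous (ContinuousAlternatingMap.apply ℝ E ℝ _)).comp hδ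

/-- Stokes: integration by parts for a product of forms with critical decay. -/
theorem exists_stokes (p q : ℕ) : ∃ c : ℝ, ∀ (γ : E → E [⋀^Fin p]→L[ℝ] ℝ)
    (δ : E → E [⋀^Fin q]→L[ℝ] ℝ) (_ : ContDiff ℝ 1 γ) (_ : ContDiff ℝ 1 δ)
    (C : ℝ) (_ : ∀ x, ‖γ x‖ * ‖δ x‖ ≤ C * (1 + ‖x‖) ^ (-(Module.finrank ℝ E : ℝ)))
    (e : Fin (p + 1 + q) → E)
    (_ : Integrable fun x => wedgeEval (p + 1) q (extDeriv γ x) (δ x) e)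
    (_ : Integrable fun x => wedgeEval p (q + 1) (γ x) (extDeriv δ x)
      (e ∘ Fin.cast (by omega))),
    ∫ x, wedgeEval p (q + 1) (γ x) (extDeriv δ x) (e ∘ Fin.cast (by omega)) =
      c * ∫ x, wedgeEval (p + 1) q (extDeriv γ x) (δ x) e := by
  obtain ⟨c, hc, h⟩ := wedgeEval_extDeriv_right (E := E) p q
  set c' : ℝ := (((p + 1).factorial * q.factorial : ℕ) : ℝ)⁻¹ * (p + 1) with hc'
  have hc0 : c' ≠ 0 := by
    have : (((p + 1).factorial * q.factorial : ℕ) : ℝ) ≠ 0 := by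
      exact_mod_cast (Nat.mul_pos (Nat.factorial_pos _) (Nat.factorial_pos _)).ne'
    have h2 : (p : ℝ) + 1 ≠ 0 := by positivity
    positivity
  refine ⟨- c * c'⁻¹, fun γ δ hγ hδ C hdec e hi1 hi2 => ?_⟩
  have hγd : ∀ x, DifferentiableAt ℝ γ x := fun x => hγ.differentiable (by simp) x
  have hδd : ∀ x, DifferentiableAt ℝ δ x := fun x => hδ.differentiable (by simp) x
  simp_rw [fun x => h (hδd x) (γ x) e, integral_const_mul] at hi2 ⊢
  simp_rw [fun x => wedgeEval_extDeriv_left (hγd x) (δ x) e] at hi1 ⊢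
  rw [← hc'] at hi1 ⊢
  rw [integral_const_mul]
  rw [integrable_const_mul_iff (isUnit_iff_ne_zero.2 hc0)] at hi1
  rw [integrable_const_mul_iff (isUnit_iff_ne_zero.2 hc)] at hi2
  have hev : ∀ {k : ℕ} {η : E → E [⋀^Fin k]→L[ℝ] ℝ} (_ : ContDiff ℝ 1 η) (w : Fin k → E),
      ContDiff ℝ 1 fun x => η x w := fun hη w =>
    (ContinuousLinearMap.contDiff (ContinuousAlternatingMap.apply ℝ E ℝ w)).comp hη
  have key := integral_sum_fderiv_eq_zero (ι := Equiv.Perm (Fin (p + 1 + q)))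
    (fun σ x => ((Equiv.Perm.sign σ : ℤ) : ℝ) * (γ x ((e ∘ σ) ∘ Fin.castAdd q ∘ Fin.succ) *
      δ x ((e ∘ σ) ∘ Fin.natAdd (p + 1)))) (fun σ => (e ∘ σ) (Fin.castAdd q 0))
    (fun σ => contDiff_const.mul ((hev hγ _).mul (hev hδ _)))
    (∑ σ : Equiv.Perm (Fin (p + 1 + q)),
      (∏ i, ‖((e ∘ σ) ∘ Fin.castAdd q ∘ Fin.succ) i‖) *
      (∏ i, ‖((e ∘ σ) ∘ Fin.natAdd (p + 1)) i‖) * C) (fun σ x => ?_)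
  · have heq : ∀ x, ∑ σ : Equiv.Perm (Fin (p + 1 + q)), fderiv ℝ (fun x =>
        ((Equiv.Perm.sign σ : ℤ) : ℝ) * (γ x ((e ∘ σ) ∘ Fin.castAdd q ∘ Fin.succ) *
        δ x ((e ∘ σ) ∘ Fin.natAdd (p + 1)))) x ((e ∘ σ) (Fin.castAdd q 0)) =
      altSum (fun w => fderiv ℝ γ x (w (Fin.castAdd q 0)) (w ∘ Fin.castAdd q ∘ Fin.succ) *
          δ x (w ∘ Fin.natAdd (p + 1))) e +
      altSum (fun w => γ x (w ∘ Fin.castAdd q ∘ Fin.succ) *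
        fderiv ℝ δ x (w (Fin.castAdd q 0)) (w ∘ Fin.natAdd (p + 1))) e := fun x => by
      rw [← altSum_add]
      unfold altSum
      refine Finset.sum_congr rfl fun σ _ => ?_
      rw [fderiv_const_mul (((hev hγ _).mul (hev hδ _)).differentiable (by simp) x),
        fderiv_fun_mul ((hev hγ _).differentiable (by simp) x)
          ((hev hδ _).differentiable (by simp) x)]
      simp only [_root_.smul_apply, _root_.add_apply, smul_eq_mul]
      rw [fderiv_continuousAlternatingMap_apply_const_apply (hγd x),
        fderiv_continuousAlternatingMap_apply_const_apply (hδd x)]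
      ring
    simp_rw [heq] at key
    have key2 := key (hi1.add hi2)
    rw [integral_add hi1 hi2] at key2
    field_simp
    linear_combination key2
  · have h0 : 0 ≤ C := by
      have := (by positivity : 0 ≤ ‖γ 0‖ * ‖δ 0‖).trans (hdec 0)
      simpa using this
    have hs : |((Equiv.Perm.sign σ : ℤ) : ℝ)| = 1 := by
      rcases Int.units_eq_one_or (Equiv.Perm.sign σ) with h | h <;> rw [h] <;> simp
    rw [abs_mul, hs, one_mul, abs_mul]
    set A := fun σ : Equiv.Perm (Fin (p + 1 + q)) =>
      (∏ i, ‖((e ∘ σ) ∘ Fin.castAdd q ∘ Fin.succ) i‖) *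
      (∏ i, ‖((e ∘ σ) ∘ Fin.natAdd (p + 1)) i‖) * C with hA
    have hA0 : ∀ σ, 0 ≤ A σ := fun σ => by positivity
    calc _ ≤ (‖γ x‖ * ∏ i, ‖((e ∘ σ) ∘ Fin.castAdd q ∘ Fin.succ) i‖) *
          (‖δ x‖ * ∏ i, ‖((e ∘ σ) ∘ Fin.natAdd (p + 1)) i‖) :=
          mul_le_mul ((γ x).le_opNorm _) ((δ x).le_opNorm _) (abs_nonneg _) (by positivity)
      _ = (∏ i, ‖((e ∘ σ) ∘ Fin.castAdd q ∘ Fin.succ) i‖) *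
          (∏ i, ‖((e ∘ σ) ∘ Fin.natAdd (p + 1)) i‖) * (‖γ x‖ * ‖δ x‖) := by ring
      _ ≤ (∏ i, ‖((e ∘ σ) ∘ Fin.castAdd q ∘ Fin.succ) i‖) *
          (∏ i, ‖((e ∘ σ) ∘ Fin.natAdd (p + 1)) i‖) *
          (C * (1 + ‖x‖) ^ (-(Module.finrank ℝ E : ℝ))) :=
          mul_le_mul_of_nonneg_left (hdec x) (by positivity)
      _ = A σ * (1 + ‖x‖) ^ (-(Module.finrank ℝ E : ℝ)) := by rw [hA]; ring
      _ ≤ _ := by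
          gcongr
          exact Finset.single_le_sum (fun σ _ => hA0 σ) (Finset.mem_univ σ)

end stokes

section volForm
variable {G E : Type*} [NormedAddCommGroup G] [InnerProductSpace ℝ G] [FiniteDimensional ℝ G]
  [NormedAddCommGroup E] [InnerProductSpace ℝ E] [FiniteDimensional ℝ E]

/-- The form `y ↦ det(y, ⋅)` attached to a top-degree form `det`, as a linear map. -/
def volForm {k : ℕ} (Δ : G [⋀^Fin (k + 1)]→L[ℝ] ℝ) : G →L[ℝ] G [⋀^Fin k]→L[ℝ] ℝ := Δ.curryLeft

theorem volForm_apply {k : ℕ} (Δ : G [⋀^Fin (k + 1)]→L[ℝ] ℝ) (y : G) (v : Fin k → G) :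
    volForm Δ y v = Δ (Matrix.vecCons y v) := rfl

theorem sum_inner_mul_eq {k : ℕ} (hk : Module.finrank ℝ G = k + 2)
    (Δ : G [⋀^Fin (k + 2)]→L[ℝ] ℝ) {a u y : G} (hau : ⟪a, u⟫ = 0) (hy : ‖y‖ = 1)
    {v : Fin (k + 1) → G} (hv : ∀ i, ⟪v i, y⟫ = 0) :
    ∑ i : Fin (k + 1), (-1 : ℝ) ^ (i : ℕ) * (⟪a, v i⟫ *
      volForm (volForm Δ a) u (v ∘ i.succAbove)) = -(‖a‖ ^ 2 * ⟪u, y⟫ * volForm Δ y v) := by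
  have hz : ContinuousAlternatingMap.alternatizeUncurryFin
      ((innerSL ℝ a).smulRight Δ) (Matrix.vecCons a (Matrix.vecCons u v)) = 0 := by
    apply AlternatingMap.map_linearDependent
      (ContinuousAlternatingMap.alternatizeUncurryFin ((innerSL ℝ a).smulRight Δ)).toAlternatingMap
    intro hli
    have := hli.fintype_card_le_finrank
    simp [hk] at this
  rw [ContinuousAlternatingMap.alternatizeUncurryFin_apply, Fin.sum_univ_succ,
    Fin.sum_univ_succ] at hz
  have h1 : Δ (Matrix.vecCons u v) = ⟪u, y⟫ * Δ (Matrix.vecCons y v) := by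
    have h2 : volForm Δ (u - ⟪u, y⟫ • y) v = 0 := by
      rw [volForm_apply]
      refine alternatingMap_eq_zero_of_orthogonal Δ.toAlternatingMap (y := y) ?_ hk.le _ ?_
      · intro h; simp [h] at hy
      · refine Fin.cases ?_ fun i => ?_
        · simp only [Matrix.cons_val_zero]
          rw [inner_sub_left, inner_smul_left, real_inner_self_eq_norm_sq, hy]; simp
        · simpa using hv i
    rw [map_sub, map_smul] at h2
    simp only [ContinuousAlternatingMap.sub_apply, ContinuousAlternatingMap.smul_apply,
      volForm_apply, smul_eq_mul] at h2
    linarith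
  have h3 : ∀ i : Fin (k + 1), (i.succ.succ).removeNth (Matrix.vecCons a (Matrix.vecCons u v)) =
      Matrix.vecCons a (Matrix.vecCons u (v ∘ i.succAbove)) := fun i => by
    ext j
    refine Fin.cases ?_ (fun j => Fin.cases ?_ (fun j => ?_) j) j
    · simp [Fin.removeNth]
    · simp [Fin.removeNth]
    · simp [Fin.removeNth]
  have h4 : (0 : Fin (k + 3)).removeNth (Matrix.vecCons a (Matrix.vecCons u v)) =
      Matrix.vecCons u v := by
    ext j; simp [Fin.removeNth]
  simp only [ContinuousLinearMap.smulRight_apply, h3, h4, Matrix.cons_val_zero,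
    Matrix.cons_val_succ, innerSL_apply_apply, hau,
    real_inner_self_eq_norm_sq, ContinuousAlternatingMap.smul_apply, h1] at hz
  simp only [volForm_apply]
  simp [pow_succ] at hz
  linear_combination hz

theorem extDeriv_ridge {k : ℕ} (hk : Module.finrank ℝ G = k + 2)
    (Δ : G [⋀^Fin (k + 2)]→L[ℝ] ℝ) {a u y : G} (hau : ⟪a, u⟫ = 0) (hy : ‖y‖ = 1)
    {f : ℝ → ℝ} (hf : Differentiable ℝ f) {v : Fin (k + 1) → G} (hv : ∀ i, ⟪v i, y⟫ = 0) :
    extDeriv (fun z => f ⟪a, z⟫ • volForm (volForm Δ a) u) y v =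
      -(‖a‖ ^ 2 * deriv f ⟪a, y⟫ * ⟪u, y⟫ * volForm Δ y v) := by
  have h0 : HasFDerivAt (fun z => f ⟪a, z⟫ • volForm (volForm Δ a) u)
      ((deriv f ⟪a, y⟫ • innerSL ℝ a).smulRight (volForm (volForm Δ a) u)) y := by
    have h1 : HasFDerivAt (fun z => f ⟪a, z⟫) (deriv f ⟪a, y⟫ • innerSL ℝ a) y :=
      (hf _).hasDerivAt.comp_hasFDerivAt y (innerSL ℝ a).hasFDerivAt
    exact h1.smul_const (volForm (volForm Δ a) u)
  rw [extDeriv_apply_eq h0.differentiableAt, h0.fderiv]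
  simp only [ContinuousLinearMap.smulRight_apply, FunLike.coe_smul, Pi.smul_apply,
    innerSL_apply_apply, smul_eq_mul, ContinuousAlternatingMap.smul_apply]
  have := sum_inner_mul_eq hk Δ hau hy hv
  calc _ = deriv f ⟪a, y⟫ * ∑ i : Fin (k + 1), (-1 : ℝ) ^ (i : ℕ) * (⟪a, v i⟫ *
      volForm (volForm Δ a) u (v ∘ i.succAbove)) := by
        rw [Finset.mul_sum]; exact Finset.sum_congr rfl fun i _ => by ring
    _ = _ := by rw [this]; ring

theorem inner_fderiv_eq_zero {h : E → G} (hh : ContDiff ℝ (⊤ : ℕ∞) h) (h1 : ∀ y, ‖h y‖ = 1)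
    (y w : E) : ⟪fderiv ℝ h y w, h y⟫ = 0 := by
  have hd : HasFDerivAt h (fderiv ℝ h y) y := (hh.differentiable (by simp) y).hasFDerivAt
  have h2 := hd.inner ℝ hd
  have h3 : (fun t => ⟪h t, h t⟫) = fun _ => (1 : ℝ) := by
    ext t; rw [real_inner_self_eq_norm_sq, h1]; simp
  rw [h3] at h2
  have h4 := congrArg (fun L : E →L[ℝ] ℝ => L w) (h2.unique (hasFDerivAt_const _ _))
  simp only [ContinuousLinearMap.comp_apply, fderivInnerCLM_apply,
    ContinuousLinearMap.prod_apply] at h4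
  rw [real_inner_comm (fderiv ℝ h y w)] at h4
  simp at h4
  exact h4

/-- Forms of degree at least the dimension pull back to zero under sphere-valued maps. -/
theorem pb_eq_zero {k : ℕ} {h : E → G} (hh : ContDiff ℝ (⊤ : ℕ∞) h) (h1 : ∀ y, ‖h y‖ = 1)
    (hk : Module.finrank ℝ G ≤ k) (ω : G → G [⋀^Fin k]→L[ℝ] ℝ) (y : E) : pb h ω y = 0 := by
  ext v
  rw [pb_apply]
  refine alternatingMap_eq_zero_of_orthogonal (ω (h y)).toAlternatingMap (y := h y) ?_ hk _
    fun i => inner_fderiv_eq_zero hh h1 y _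
  intro h0; have := h1 y; simp [h0] at this

theorem extDeriv_pb_ridge {k : ℕ} (hk : Module.finrank ℝ G = k + 2)
    (Δ : G [⋀^Fin (k + 2)]→L[ℝ] ℝ) {a u : G} (hau : ⟪a, u⟫ = 0)
    {f : ℝ → ℝ} (hf : ContDiff ℝ (⊤ : ℕ∞) f)
    {h : E → G} (hh : ContDiff ℝ (⊤ : ℕ∞) h) (h1 : ∀ y, ‖h y‖ = 1) (y : E) :
    extDeriv (pb h fun z => f ⟪a, z⟫ • volForm (volForm Δ a) u) y =
      (-(‖a‖ ^ 2 * deriv f ⟪a, h y⟫ * ⟪u, h y⟫)) • pb h (fun z => volForm Δ z) y := by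
  rw [extDeriv_pb hh]
  · ext v
    rw [pb_apply, extDeriv_ridge hk Δ hau (h1 y) (hf.differentiable (by simp))
      fun i => inner_fderiv_eq_zero hh h1 y _]
    simp only [ContinuousAlternatingMap.smul_apply, pb_apply, smul_eq_mul]
    ring
  · exact (hf.comp (innerSL ℝ a).contDiff).smul contDiff_const

end volForm

section invMeasure
variable {G Ω : Type*} [NormedAddCommGroup G] [InnerProductSpace ℝ G] [FiniteDimensional ℝ G]
  [MeasurableSpace G] [BorelSpace G] [MeasurableSpace Ω]
  {ν : Measure Ω} [SFinite ν] {μ : Measure G} [IsFiniteMeasure μ] {h : Ω → G}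

theorem integral_mix {Y : Type*} [NormedAddCommGroup Y] [NormedSpace ℝ Y]
    [MeasurableSpace Y] [BorelSpace Y] [SecondCountableTopology Y]
    (hh : Measurable h) (h1 : ∀ y, ‖h y‖ = 1)
    (hμ : ∀ᵐ x ∂μ, ‖x‖ = 1) {ρ : Ω → NNReal} (hρ : Measurable ρ)
    (hi : Integrable (fun y => (ρ y : ℝ)) ν) {F : G → Y} (hF : Measurable F) {B : ℝ}
    (hB : ∀ x, ‖x‖ = 1 → ‖F x‖ ≤ B) (M c : NNReal) :
    ∫ x, F x ∂(M • (ν.withDensity fun y => (ρ y : ENNReal)).map h + c • μ) =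
      M • ∫ y, (ρ y : ℝ) • F (h y) ∂ν + c • ∫ x, F x ∂μ := by
  have hint2 : Integrable F μ := by
    refine Integrable.of_bound hF.aestronglyMeasurable B ?_
    filter_upwards [hμ] with x hx using hB x hx
  have hint1 : Integrable F ((ν.withDensity fun y => (ρ y : ENNReal)).map h) := by
    rw [integrable_map_measure hF.aestronglyMeasurable hh.aemeasurable,
      integrable_withDensity_iff_integrable_smul hρ]
    refine (hi.mul_const B).mono' ?_ (Filter.Eventually.of_forall fun y => ?_)
    · exact (hρ.smul (hF.comp hh)).aestronglyMeasurable
    · rw [NNReal.smul_def, norm_smul, NNReal.norm_eq]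
      exact mul_le_mul_of_nonneg_left (hB _ (h1 y)) (NNReal.coe_nonneg _)
  rw [integral_add_measure, integral_smul_nnreal_measure, integral_smul_nnreal_measure,
    integral_map hh.aemeasurable hF.aestronglyMeasurable, integral_withDensity_eq_integral_smul hρ]
  · rfl
  · exact hint1.smul_measure_nnreal
  · exact hint2.smul_measure_nnreal

theorem integrable_mul_of_bounded {ρ : Ω → ℝ} (hi : Integrable ρ ν) {g : Ω → ℝ}
    (hg : Measurable g) {B : ℝ} (hB : ∀ y, |g y| ≤ B) : Integrable (fun y => g y * ρ y) ν :=
  hi.bdd_mul hg.aestronglyMeasurable (c := B) (Filter.Eventually.of_forall hB)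

theorem integral_cos_eq_of_orthogonal (hh : Measurable h) (h1 : ∀ y, ‖h y‖ = 1) {ρ : Ω → ℝ}
    (hi : Integrable ρ ν)
    (H : ∀ a u : G, a ≠ 0 → ⟪a, u⟫ = 0 → ∀ θ : ℝ,
      ∫ y, Real.cos (⟪a, h y⟫ + θ) * ⟪u, h y⟫ * ρ y ∂ν = 0) (θ : ℝ) {a b : G} (ha : a ≠ 0)
    (hab : ⟪a, b⟫ = 0) (hn : ‖a‖ = ‖b‖) :
    ∫ y, Real.cos (⟪a, h y⟫ + θ) * ρ y ∂ν = ∫ y, Real.cos (⟪b, h y⟫ + θ) * ρ y ∂ν := by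
  let γ : ℝ → G := fun s => Real.cos s • a + Real.sin s • b
  let γ' : ℝ → G := fun s => -Real.sin s • a + Real.cos s • b
  have hγ' : ∀ s, HasDerivAt γ (γ' s) s := fun s =>
    ((Real.hasDerivAt_cos s).smul_const a).add ((Real.hasDerivAt_sin s).smul_const b)
  have hba : ⟪b, a⟫ = 0 := by rw [real_inner_comm]; exact hab
  have hmγ : ∀ v : G, Measurable fun y => ⟪v, h y⟫ := fun v => hh.const_inner
  have hperp : ∀ s, ⟪γ s, γ' s⟫ = 0 := fun s => by
    simp only [γ, γ', inner_add_left, inner_add_right, inner_smul_left, inner_smul_right,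
      real_inner_self_eq_norm_sq, hab, hba, hn, conj_trivial]
    ring
  have hne : ∀ s, γ s ≠ 0 := fun s h0 => by
    have : ⟪γ s, γ s⟫ = ‖a‖ ^ 2 := by
      simp only [γ, inner_add_left, inner_add_right, inner_smul_left, inner_smul_right,
        real_inner_self_eq_norm_sq, hab, hba, hn, conj_trivial]
      linear_combination ‖b‖ ^ 2 * Real.sin_sq_add_cos_sq s
    rw [h0, inner_zero_left] at this
    exact ha (norm_eq_zero.1 (pow_eq_zero_iff two_ne_zero |>.1 this.symm))
  have hnormγ' : ∀ s, ‖γ' s‖ ≤ ‖a‖ + ‖b‖ := fun s => by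
    refine (norm_add_le _ _).trans (add_le_add ?_ ?_)
    · rw [norm_smul, norm_neg]
      exact mul_le_of_le_one_left (norm_nonneg _) (Real.abs_sin_le_one s)
    · rw [norm_smul]
      exact mul_le_of_le_one_left (norm_nonneg _) (Real.abs_cos_le_one s)
  have hder : ∀ s, HasDerivAt (fun s => ∫ y, Real.cos (⟪γ s, h y⟫ + θ) * ρ y ∂ν) 0 s := fun s => by
    have := hasDerivAt_integral_of_dominated_loc_of_deriv_le (μ := ν) (s := univ) (x₀ := s)
      (F := fun s y => Real.cos (⟪γ s, h y⟫ + θ) * ρ y)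
      (F' := fun s y => -Real.sin (⟪γ s, h y⟫ + θ) * ⟪γ' s, h y⟫ * ρ y)
      (bound := fun y => (‖a‖ + ‖b‖) * |ρ y|) Filter.univ_mem
      (Filter.Eventually.of_forall fun s => ?_) ?_ ?_ (Filter.Eventually.of_forall fun y s _ => ?_)
      (hi.abs.const_mul _) (Filter.Eventually.of_forall fun y s _ => ?_)
    · have hH := H (γ s) (γ' s) (hne s) (hperp s) (θ + Real.pi / 2)
      simp only [← add_assoc, Real.cos_add_pi_div_two] at hH
      have := this.2
      rwa [hH] at this
    · exact ((Real.measurable_cos.comp ((hmγ _).add_const θ)).aestronglyMeasurable).mul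
        hi.aestronglyMeasurable
    · exact integrable_mul_of_bounded hi (Real.measurable_cos.comp ((hmγ _).add_const θ))
        fun y => Real.abs_cos_le_one _
    · exact (((Real.measurable_sin.comp ((hmγ _).add_const θ)).neg.mul
        (hmγ _)).aestronglyMeasurable).mul hi.aestronglyMeasurable
    · rw [Real.norm_eq_abs, abs_mul]
      refine mul_le_mul_of_nonneg_right ?_ (abs_nonneg _)
      rw [abs_mul, abs_neg]
      refine (mul_le_of_le_one_left (abs_nonneg _) (Real.abs_sin_le_one _)).trans ?_
      refine (abs_real_inner_le_norm _ _).trans ?_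
      rw [h1, mul_one]; exact hnormγ' s
    · have h2 : HasDerivAt (fun s => ⟪γ s, h y⟫ + θ) ⟪γ' s, h y⟫ s := by
        have := (hγ' s).inner ℝ (hasDerivAt_const s (h y))
        simpa using this.add_const θ
      exact h2.cos.mul_const _
  have hconst := is_const_of_deriv_eq_zero (fun s => (hder s).differentiableAt)
    (fun s => (hder s).deriv) 0 (Real.pi / 2)
  simpa [γ] using hconst

theorem exists_orthogonal_pair (hdim : 3 ≤ Module.finrank ℝ G) (s t : G) :
    ∃ b : G, ⟪s, b⟫ = 0 ∧ ⟪t, b⟫ = 0 ∧ ‖b‖ = ‖s‖ := by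
  have h1 : Module.finrank ℝ (Submodule.span ℝ {s, t}) ≤ 2 := by
    classical
    have := finrank_span_finset_le_card (R := ℝ) ({s, t} : Finset G)
    rw [Finset.coe_pair] at this
    exact this.trans Finset.card_le_two
  have h2 := (Submodule.span ℝ {s, t}).finrank_add_finrank_orthogonal
  have h3 : 0 < Module.finrank ℝ (Submodule.span ℝ {s, t})ᗮ := by omega
  obtain ⟨⟨b, hb⟩, hb0⟩ := (Module.finrank_pos_iff_exists_ne_zero).1 h3
  have hb0' : ‖b‖ ≠ 0 := by simpa using hb0
  refine ⟨(‖s‖ * ‖b‖⁻¹) • b, ?_, ?_, ?_⟩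
  · rw [inner_smul_right, hb s (Submodule.subset_span (by simp)), mul_zero]
  · rw [inner_smul_right, hb t (Submodule.subset_span (by simp)), mul_zero]
  · rw [norm_smul, Real.norm_of_nonneg (by positivity), mul_assoc, inv_mul_cancel₀ hb0', mul_one]

theorem integral_cos_eq (hdim : 3 ≤ Module.finrank ℝ G) (hh : Measurable h)
    (h1 : ∀ y, ‖h y‖ = 1) {ρ : Ω → ℝ} (hi : Integrable ρ ν)
    (H : ∀ a u : G, a ≠ 0 → ⟪a, u⟫ = 0 → ∀ θ : ℝ,
      ∫ y, Real.cos (⟪a, h y⟫ + θ) * ⟪u, h y⟫ * ρ y ∂ν = 0) (θ : ℝ) {s t : G}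
    (hn : ‖s‖ = ‖t‖) :
    ∫ y, Real.cos (⟪s, h y⟫ + θ) * ρ y ∂ν = ∫ y, Real.cos (⟪t, h y⟫ + θ) * ρ y ∂ν := by
  by_cases hs : s = 0
  · have : t = 0 := by rw [hs, norm_zero] at hn; simpa using hn.symm
    rw [hs, this]
  · obtain ⟨b, hb1, hb2, hb3⟩ := exists_orthogonal_pair hdim s t
    have ht : t ≠ 0 := fun h0 => hs (by simpa [h0] using hn)
    rw [integral_cos_eq_of_orthogonal hh h1 hi H θ hs hb1 hb3.symm,
      integral_cos_eq_of_orthogonal hh h1 hi H θ ht hb2 (hn ▸ hb3.symm)]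

theorem integral_cos_eq_of_invariant (hinv : ∀ R : G ≃ₗᵢ[ℝ] G, μ.map R = μ) (θ : ℝ) {s t : G}
    (hn : ‖s‖ = ‖t‖) :
    ∫ x, Real.cos (⟪s, x⟫ + θ) ∂μ = ∫ x, Real.cos (⟪t, x⟫ + θ) ∂μ := by
  set R := (ℝ ∙ (s - t))ᗮ.reflection with hR
  have hRs : R s = t := Submodule.reflection_sub hn
  have hm : Measurable fun x : G => Real.cos (⟪t, x⟫ + θ) :=
    Real.measurable_cos.comp (measurable_id.const_inner.add_const θ)
  conv_rhs => rw [← hinv R]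
  rw [integral_map R.continuous.measurable.aemeasurable hm.aestronglyMeasurable]
  refine integral_congr_ae (Filter.Eventually.of_forall fun x => ?_)
  simp only
  rw [← hRs, LinearIsometryEquiv.inner_map_map]

theorem mul_integral_cos (hdim : 3 ≤ Module.finrank ℝ G) (hh : Measurable h)
    (h1 : ∀ y, ‖h y‖ = 1) {ρ : Ω → ℝ} (hi : Integrable ρ ν)
    (hμ : ∀ᵐ x ∂μ, ‖x‖ = 1) (hinv : ∀ R : G ≃ₗᵢ[ℝ] G, μ.map R = μ)
    (H : ∀ a u : G, a ≠ 0 → ⟪a, u⟫ = 0 → ∀ θ : ℝ,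
      ∫ y, Real.cos (⟪a, h y⟫ + θ) * ⟪u, h y⟫ * ρ y ∂ν = 0) (θ : ℝ) (t : G) :
    μ.real univ * ∫ y, Real.cos (⟪t, h y⟫ + θ) * ρ y ∂ν =
      (∫ y, ρ y ∂ν) * ∫ x, Real.cos (⟪t, x⟫ + θ) ∂μ := by
  have e1 : ∫ x, (∫ y, Real.cos (‖t‖ * ⟪x, h y⟫ + θ) * ρ y ∂ν) ∂μ =
      μ.real univ * ∫ y, Real.cos (⟪t, h y⟫ + θ) * ρ y ∂ν := by
    rw [← smul_eq_mul, ← integral_const]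
    refine integral_congr_ae ?_
    filter_upwards [hμ] with x hx
    rw [← integral_cos_eq hdim hh h1 hi H θ (s := ‖t‖ • x) (t := t) (by simp [norm_smul, hx])]
    simp only [inner_smul_left]; rfl
  have e2 : ∫ y, (∫ x, Real.cos (‖t‖ * ⟪x, h y⟫ + θ) * ρ y ∂μ) ∂ν =
      (∫ y, ρ y ∂ν) * ∫ x, Real.cos (⟪t, x⟫ + θ) ∂μ := by
    rw [← integral_mul_const]
    refine integral_congr_ae (Filter.Eventually.of_forall fun y => ?_)
    simp only
    rw [integral_mul_const, mul_comm]
    congr 1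
    rw [← integral_cos_eq_of_invariant hinv θ (s := ‖t‖ • h y) (t := t) (by simp [norm_smul, h1])]
    simp only [inner_smul_left, real_inner_comm]; rfl
  rw [← e1, ← e2]
  refine integral_integral_swap ?_
  have hm : Measurable fun z : G × Ω => Real.cos (‖t‖ * ⟪z.1, h z.2⟫ + θ) :=
    Real.measurable_cos.comp (((measurable_fst.inner (hh.comp measurable_snd)).const_mul
      _).add_const θ)
  exact (hi.comp_snd μ).bdd_mul hm.aestronglyMeasurable (c := 1)
    (Filter.Eventually.of_forall fun z => Real.abs_cos_le_one _)

theorem mul_integral_comp (hdim : 3 ≤ Module.finrank ℝ G) (hh : Measurable h)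
    (h1 : ∀ y, ‖h y‖ = 1) {ρ : Ω → ℝ} (hρ : Measurable ρ) (hi : Integrable ρ ν)
    (hμ : ∀ᵐ x ∂μ, ‖x‖ = 1) (hinv : ∀ R : G ≃ₗᵢ[ℝ] G, μ.map R = μ)
    (H : ∀ a u : G, a ≠ 0 → ⟪a, u⟫ = 0 → ∀ θ : ℝ,
      ∫ y, Real.cos (⟪a, h y⟫ + θ) * ⟪u, h y⟫ * ρ y ∂ν = 0) {φ : G → ℝ} (hφ : Measurable φ)
    {B : ℝ} (hB : ∀ x, ‖x‖ = 1 → |φ x| ≤ B) :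
    μ.real univ * ∫ y, φ (h y) * ρ y ∂ν = (∫ y, ρ y ∂ν) * ∫ x, φ x ∂μ := by
  let ρp : Ω → NNReal := fun y => Real.toNNReal (ρ y)
  let ρm : Ω → NNReal := fun y => Real.toNNReal (-ρ y)
  have hρp : Measurable ρp := hρ.real_toNNReal
  have hρm : Measurable ρm := hρ.neg.real_toNNReal
  have hip : Integrable (fun y => (ρp y : ℝ)) ν := hi.real_toNNReal
  have him : Integrable (fun y => (ρm y : ℝ)) ν := hi.neg.real_toNNReal
  have hpm : ∀ y, ρ y = (ρp y : ℝ) - ρm y := fun y => by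
    simp only [ρp, ρm, Real.coe_toNNReal']
    exact (max_zero_sub_eq_self (ρ y)).symm
  let M : NNReal := ⟨μ.real univ, measureReal_nonneg⟩
  let cp : NNReal := ⟨∫ y, (ρp y : ℝ) ∂ν, integral_nonneg fun _ => NNReal.coe_nonneg _⟩
  let cm : NNReal := ⟨∫ y, (ρm y : ℝ) ∂ν, integral_nonneg fun _ => NNReal.coe_nonneg _⟩
  have hcc : (∫ y, ρ y ∂ν) = (cp : ℝ) - cm := by
    simp_rw [hpm]; exact integral_sub hip him
  have key : ∀ {Y : Type} [NormedAddCommGroup Y] [NormedSpace ℝ Y] [MeasurableSpace Y]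
      [BorelSpace Y] [SecondCountableTopology Y] (F : G → Y) (_ : Measurable F) (B : ℝ)
      (_ : ∀ x, ‖x‖ = 1 → ‖F x‖ ≤ B),
      ((∫ x, F x ∂(M • (ν.withDensity fun y => (ρp y : ENNReal)).map h + cm • μ)) =
      (∫ x, F x ∂(M • (ν.withDensity fun y => (ρm y : ENNReal)).map h + cp • μ)) ↔
      μ.real univ • ∫ y, ρ y • F (h y) ∂ν = (∫ y, ρ y ∂ν) • ∫ x, F x ∂μ) := by
    intro Y _ _ _ _ _ F hF B hB
    rw [integral_mix hh h1 hμ hρp hip hF hB, integral_mix hh h1 hμ hρm him hF hB, hcc]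
    have hFi : ∀ {r : Ω → NNReal}, Measurable r → Integrable (fun y => (r y : ℝ)) ν →
        Integrable (fun y => (r y : ℝ) • F (h y)) ν := fun {r} hr hri => by
      refine (hri.mul_const B).mono' ?_ (Filter.Eventually.of_forall fun y => ?_)
      · exact (hr.coe_nnreal_real.smul (hF.comp hh)).aestronglyMeasurable
      · rw [norm_smul, NNReal.norm_eq]
        exact mul_le_mul_of_nonneg_left (hB _ (h1 y)) (NNReal.coe_nonneg _)
    have : ∫ y, ρ y • F (h y) ∂ν = ∫ y, (ρp y : ℝ) • F (h y) ∂ν -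
        ∫ y, (ρm y : ℝ) • F (h y) ∂ν := by
      rw [← integral_sub (hFi hρp hip) (hFi hρm him)]
      simp_rw [hpm, sub_smul]
    rw [this, sub_smul, smul_sub]
    change (M : ℝ) • (_ : Y) + (cm : ℝ) • (_ : Y) = (M : ℝ) • (_ : Y) + (cp : ℝ) • (_ : Y) ↔
      (M : ℝ) • (_ : Y) - (M : ℝ) • (_ : Y) = _
    rw [sub_eq_sub_iff_add_eq_add, add_comm ((M : ℝ) • ∫ y, (ρm y : ℝ) • F (h y) ∂ν)]
  have hfin : ∀ {r : Ω → NNReal}, Integrable (fun y => (r y : ℝ)) ν →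
      IsFiniteMeasure ((ν.withDensity fun y => (r y : ENNReal)).map h) := fun {r} hri => by
    have : IsFiniteMeasure (ν.withDensity fun y => (r y : ENNReal)) := by
      refine isFiniteMeasure_withDensity ?_
      have := hri.lintegral_lt_top
      simpa using this.ne
    infer_instance
  have := hfin hip
  have := hfin him
  have hmeas : M • (ν.withDensity fun y => (ρp y : ENNReal)).map h + cm • μ =
      M • (ν.withDensity fun y => (ρm y : ENNReal)).map h + cp • μ := by
    refine Measure.ext_of_charFun (funext fun t => ?_)
    rw [charFun_apply, charFun_apply]
    have hexp : ∀ x : G, Complex.exp (⟪x, t⟫ * Complex.I) =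
        (Real.cos (⟪t, x⟫ + 0) : ℂ) + (Real.cos (⟪t, x⟫ + -(Real.pi / 2)) : ℂ) * Complex.I := by
      intro x
      rw [Complex.exp_mul_I, real_inner_comm, ← sub_eq_add_neg, Real.cos_sub_pi_div_two]
      simp
    have hcosm : ∀ θ, Measurable fun x : G => Real.cos (⟪t, x⟫ + θ) := fun θ =>
      Real.measurable_cos.comp (measurable_id.const_inner.add_const θ)
    rw [key (fun x : G => Complex.exp (⟪x, t⟫ * Complex.I)) (by fun_prop) 1
      (fun x _ => by rw [Complex.norm_exp_ofReal_mul_I])]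
    have hiθ : ∀ θ, Integrable (fun y => Real.cos (⟪t, h y⟫ + θ) * ρ y) ν := fun θ =>
      integrable_mul_of_bounded hi ((hcosm θ).comp hh) fun y => Real.abs_cos_le_one _
    have hiθ' : ∀ θ, Integrable (fun x => Real.cos (⟪t, x⟫ + θ)) μ := fun θ =>
      Integrable.of_bound (hcosm θ).aestronglyMeasurable 1
        (Filter.Eventually.of_forall fun y => Real.abs_cos_le_one _)
    have i1 : ∫ y, ρ y • Complex.exp (⟪h y, t⟫ * Complex.I) ∂ν =
        ((∫ y, Real.cos (⟪t, h y⟫ + 0) * ρ y ∂ν : ℝ) : ℂ) +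
        ((∫ y, Real.cos (⟪t, h y⟫ + -(Real.pi / 2)) * ρ y ∂ν : ℝ) : ℂ) * Complex.I := by
      rw [← integral_complex_ofReal, ← integral_complex_ofReal, ← integral_mul_const, ← integral_add]
      · refine integral_congr_ae (Filter.Eventually.of_forall fun y => ?_)
        simp only [hexp, Complex.real_smul]
        push_cast; ring
      · exact (hiθ 0).ofReal
      · exact (hiθ _).ofReal.mul_const _
    have i2 : ∫ x, Complex.exp (⟪x, t⟫ * Complex.I) ∂μ =
        ((∫ x, Real.cos (⟪t, x⟫ + 0) ∂μ : ℝ) : ℂ) +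
        ((∫ x, Real.cos (⟪t, x⟫ + -(Real.pi / 2)) ∂μ : ℝ) : ℂ) * Complex.I := by
      rw [← integral_complex_ofReal, ← integral_complex_ofReal, ← integral_mul_const, ← integral_add]
      · refine integral_congr_ae (Filter.Eventually.of_forall fun y => ?_)
        simp only [hexp]
      · exact (hiθ' 0).ofReal
      · exact (hiθ' _).ofReal.mul_const _
    rw [i1, i2]
    have k1 := mul_integral_cos hdim hh h1 hi hμ hinv H 0 t
    have k2 := mul_integral_cos hdim hh h1 hi hμ hinv H (-(Real.pi / 2)) t
    have k1' := congrArg (fun x : ℝ => (x : ℂ)) k1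
    have k2' := congrArg (fun x : ℝ => (x : ℂ)) k2
    simp only [Complex.ofReal_mul] at k1' k2'
    simp only [Complex.real_smul]
    linear_combination k1' + Complex.I * k2'
  have hfinal := (key φ hφ B hB).1 (by rw [hmeas])
  simp only [smul_eq_mul] at hfinal
  rw [← hfinal]
  simp_rw [mul_comm (ρ _)]

end invMeasure

section invForms
variable {G E : Type*} [NormedAddCommGroup G] [InnerProductSpace ℝ G] [FiniteDimensional ℝ G]
  [MeasurableSpace G] [BorelSpace G]
  [NormedAddCommGroup E] [InnerProductSpace ℝ E] [FiniteDimensional ℝ E]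
  [MeasurableSpace E] [BorelSpace E]

theorem integrable_of_decay {f : E → ℝ} (hf : Continuous f) {C r : ℝ}
    (hr : (Module.finrank ℝ E : ℝ) < r) (hd : ∀ x, |f x| ≤ C * (1 + ‖x‖) ^ (-r)) :
    Integrable f :=
  ((integrable_one_add_norm hr).const_mul C).mono' hf.aestronglyMeasurable
    (Filter.Eventually.of_forall hd)

theorem one_add_norm_rpow_le (x : E) {r s : ℝ} (h : s ≤ r) :
    (1 + ‖x‖) ^ (-r) ≤ (1 + ‖x‖) ^ (-s) :=
  Real.rpow_le_rpow_of_exponent_le (by linarith [norm_nonneg x]) (by linarith)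

theorem norm_pb_le_decay {k : ℕ} {h : E → G} {C : ℝ}
    (hdec : ∀ y, ‖fderiv ℝ h y‖ ≤ C * (1 + ‖y‖) ^ (-2 : ℝ)) (ω : G → G [⋀^Fin k]→L[ℝ] ℝ)
    {M : ℝ} (hM : ∀ y, ‖ω (h y)‖ ≤ M) (y : E) :
    ‖pb h ω y‖ ≤ M * C ^ k * (1 + ‖y‖) ^ (-(2 * k : ℝ)) := by
  have hM0 : 0 ≤ M := (norm_nonneg _).trans (hM y)
  refine (norm_pb_le h ω y).trans ?_
  calc _ ≤ M * (C * (1 + ‖y‖) ^ (-2 : ℝ)) ^ k := by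
        gcongr
        · exact hM y
        · exact hdec y
    _ = _ := by
        rw [mul_pow, ← Real.rpow_mul_natCast (by positivity)]; ring_nf

theorem norm_volForm_le {k : ℕ} (Δ : G [⋀^Fin (k + 1)]→L[ℝ] ℝ) {y : G} (hy : ‖y‖ = 1) :
    ‖volForm Δ y‖ ≤ ‖volForm Δ‖ := by
  have := (volForm Δ).le_opNorm y
  rwa [hy, mul_one] at this

theorem wedge_decay {p q : ℕ} {γ : E → E [⋀^Fin p]→L[ℝ] ℝ} {δ : E → E [⋀^Fin q]→L[ℝ] ℝ}
    {A B r s : ℝ} (hA : ∀ y, ‖γ y‖ ≤ A * (1 + ‖y‖) ^ (-r))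
    (hB : ∀ y, ‖δ y‖ ≤ B * (1 + ‖y‖) ^ (-s)) (y : E) :
    ‖γ y‖ * ‖δ y‖ ≤ A * B * (1 + ‖y‖) ^ (-(r + s)) := by
  calc _ ≤ (A * (1 + ‖y‖) ^ (-r)) * (B * (1 + ‖y‖) ^ (-s)) :=
        mul_le_mul (hA y) (hB y) (norm_nonneg _) ((norm_nonneg _).trans (hA y))
    _ = _ := by
        rw [neg_add, Real.rpow_add (by positivity)]; ring

theorem integrable_wedge {p q : ℕ} {γ : E → E [⋀^Fin p]→L[ℝ] ℝ} {δ : E → E [⋀^Fin q]→L[ℝ] ℝ}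
    (hγ : Continuous γ) (hδ : Continuous δ)
    {A B r s : ℝ} (hA : ∀ y, ‖γ y‖ ≤ A * (1 + ‖y‖) ^ (-r))
    (hB : ∀ y, ‖δ y‖ ≤ B * (1 + ‖y‖) ^ (-s)) (hrs : (Module.finrank ℝ E : ℝ) < r + s)
    {e : Fin (p + q) → E} (he : ∀ i, ‖e i‖ ≤ 1) :
    Integrable fun y => wedgeEval p q (γ y) (δ y) e := by
  refine integrable_of_decay (continuous_wedgeEval hγ hδ e) hrs
    (C := (p + q).factorial * (A * B)) fun y => ?_
  refine (abs_wedgeEval_le p q (γ y) (δ y) he).trans ?_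
  rw [mul_assoc]
  exact mul_le_mul_of_nonneg_left (wedge_decay hA hB y) (by positivity)

theorem invariant_integral {p k : ℕ} (hk : 1 ≤ k) (hG : Module.finrank ℝ G = k + 2)
    (hE : Module.finrank ℝ E = p + 1 + k) (Δ : G [⋀^Fin (k + 2)]→L[ℝ] ℝ)
    {h : E → G} (hh : ContDiff ℝ (⊤ : ℕ∞) h) (h1 : ∀ y, ‖h y‖ = 1) {C : ℝ}
    (hdec : ∀ y, ‖fderiv ℝ h y‖ ≤ C * (1 + ‖y‖) ^ (-2 : ℝ))
    {γ : E → E [⋀^Fin p]→L[ℝ] ℝ} (hγ : ContDiff ℝ 1 γ) {A : ℝ}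
    (hA : ∀ y, ‖γ y‖ ≤ A * (1 + ‖y‖) ^ (-(p : ℝ)))
    {e : Fin (p + 1 + k) → E} (he : ∀ i, ‖e i‖ ≤ 1)
    (hvan : ∀ (η : G → G [⋀^Fin k]→L[ℝ] ℝ), ∀ y,
      wedgeEval (p + 1) k (extDeriv γ y) (pb h η y) e = 0)
    {μ : Measure G} [IsFiniteMeasure μ] (hμ : ∀ᵐ x ∂μ, ‖x‖ = 1)
    (hinv : ∀ R : G ≃ₗᵢ[ℝ] G, μ.map R = μ)
    {φ : G → ℝ} (hφ : Measurable φ) {B : ℝ} (hB : ∀ x, ‖x‖ = 1 → |φ x| ≤ B) :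
    μ.real univ * ∫ y, φ (h y) * wedgeEval p (k + 1) (γ y) (pb h (fun z => volForm Δ z) y)
        (e ∘ Fin.cast (by omega)) =
      (∫ y, wedgeEval p (k + 1) (γ y) (pb h (fun z => volForm Δ z) y)
        (e ∘ Fin.cast (by omega))) * ∫ x, φ x ∂μ := by
  have hVs : ContDiff ℝ (⊤ : ℕ∞) (pb h fun z => volForm Δ z) := contDiff_pb hh (volForm Δ).contDiff
  have hVd := norm_pb_le_decay hdec (fun z => volForm Δ z) (M := ‖volForm Δ‖)
    fun y => norm_volForm_le Δ (h1 y)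
  have hint : Integrable fun y => wedgeEval p (k + 1) (γ y) (pb h (fun z => volForm Δ z) y)
      (e ∘ Fin.cast (by omega)) := by
    refine integrable_wedge hγ.continuous hVs.continuous hA hVd ?_ fun i => he _
    rw [hE]; push_cast; linarith
  refine mul_integral_comp (by omega) hh.continuous.measurable h1
    (continuous_wedgeEval hγ.continuous hVs.continuous _).measurable hint hμ hinv ?_ hφ hB
  intro a u ha hau θ
  have hf : ContDiff ℝ (⊤ : ℕ∞) fun t : ℝ => Real.sin (t + θ) :=
    Real.contDiff_sin.comp (contDiff_id.add contDiff_const)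
  have hfd : ∀ t, deriv (fun t : ℝ => Real.sin (t + θ)) t = Real.cos (t + θ) := fun t => by simp
  set η : G → G [⋀^Fin k]→L[ℝ] ℝ := fun z => Real.sin (⟪a, z⟫ + θ) • volForm (volForm Δ a) u
  have hη : ContDiff ℝ (⊤ : ℕ∞) η :=
    (hf.comp (innerSL ℝ a).contDiff).smul contDiff_const
  have hηM : ∀ y, ‖η (h y)‖ ≤ ‖volForm (volForm Δ a) u‖ := fun y => by
    rw [norm_smul]
    exact mul_le_of_le_one_left (norm_nonneg _) (Real.abs_sin_le_one _)
  have hηd := norm_pb_le_decay hdec η hηM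
  have hext : ∀ y, extDeriv (pb h η) y =
      (-(‖a‖ ^ 2 * Real.cos (⟪a, h y⟫ + θ) * ⟪u, h y⟫)) • pb h (fun z => volForm Δ z) y :=
    fun y => by
      have := extDeriv_pb_ridge hG Δ hau hf hh h1 y
      rwa [hfd] at this
  have hw : ∀ y, wedgeEval p (k + 1) (γ y) (extDeriv (pb h η) y) (e ∘ Fin.cast (by omega)) =
      -(‖a‖ ^ 2) * (Real.cos (⟪a, h y⟫ + θ) * ⟪u, h y⟫ * wedgeEval p (k + 1) (γ y)
        (pb h (fun z => volForm Δ z) y) (e ∘ Fin.cast (by omega))) := fun y => by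
    rw [hext]
    refine (wedgeEval_smul_right p (k + 1) (γ y) (pb h (fun z => volForm Δ z) y)
      (-(‖a‖ ^ 2 * Real.cos (⟪a, h y⟫ + θ) * ⟪u, h y⟫)) (e ∘ Fin.cast (by omega))).trans ?_
    ring
  obtain ⟨c, hc⟩ := exists_stokes (E := E) p k
  have hcoef : Measurable fun y => Real.cos (⟪a, h y⟫ + θ) * ⟪u, h y⟫ :=
    (Real.measurable_cos.comp (hh.continuous.measurable.const_inner.add_const θ)).mul
      hh.continuous.measurable.const_inner
  have hst := hc γ (pb h η) hγ ((contDiff_pb hh hη).of_le (by exact_mod_cast le_top))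
    (A * (‖volForm (volForm Δ a) u‖ * C ^ k)) (fun y => (wedge_decay hA hηd y).trans ?_) e ?_ ?_
  · simp_rw [hw, hvan η, integral_zero, mul_zero, integral_const_mul] at hst
    have ha' : -‖a‖ ^ 2 ≠ 0 := by
      have := norm_pos_iff.2 ha
      have : 0 < ‖a‖ ^ 2 := by positivity
      linarith
    exact (mul_eq_zero.1 hst).resolve_left ha'
  · have hC : 0 ≤ A * (‖volForm (volForm Δ a) u‖ * C ^ k) := by
      have h2 := (norm_nonneg _).trans (hA 0)
      have h3 := (norm_nonneg _).trans (hdec 0)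
      simp at h2 h3
      positivity
    refine mul_le_mul_of_nonneg_left (one_add_norm_rpow_le y ?_) hC
    rw [hE]
    have : (1 : ℝ) ≤ k := by exact_mod_cast hk
    push_cast; linarith
  · simp_rw [hvan η]; exact integrable_zero _ _ _
  · simp_rw [hw]
    refine (integrable_mul_of_bounded hint hcoef (B := ‖u‖) fun y => ?_).const_mul _
    rw [abs_mul]
    refine (mul_le_of_le_one_left (abs_nonneg _) (Real.abs_cos_le_one _)).trans ?_
    refine (abs_real_inner_le_norm _ _).trans ?_
    rw [h1, mul_one]

end invForms

section stereo
variable {G E : Type*} [NormedAddCommGroup G] [InnerProductSpace ℝ G]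
  [NormedAddCommGroup E] [InnerProductSpace ℝ E]

/-- Inverse stereographic projection from the pole `v`, in the coordinates `J` of `vᗮ`. -/
def invStereo (J : E →ₗᵢ[ℝ] G) (v : G) (y : E) : G := v + (2 / (‖y‖ ^ 2 + 1)) • (J y - v)

variable {J : E →ₗᵢ[ℝ] G} {v : G}

theorem norm_invStereo (hv : ‖v‖ = 1) (hJ : ∀ y, ⟪J y, v⟫ = 0) (y : E) : ‖invStereo J v y‖ = 1 := by
  have h2 : ‖invStereo J v y‖ ^ 2 = 1 := by
    have hs : ‖y‖ ^ 2 + 1 ≠ 0 := by positivity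
    rw [invStereo, norm_add_sq_real, norm_smul, mul_pow, norm_sub_sq_real, J.norm_map, hJ, hv,
      real_inner_smul_right, inner_sub_right, real_inner_comm, hJ, real_inner_self_eq_norm_sq, hv,
      Real.norm_eq_abs, sq_abs]
    field_simp
    ring
  nlinarith [norm_nonneg (invStereo J v y)]

theorem contDiff_invStereo : ContDiff ℝ (⊤ : ℕ∞) (invStereo J v) := by
  unfold invStereo
  refine contDiff_const.add (ContDiff.smul ?_ (J.contDiff.sub contDiff_const))
  exact contDiff_const.div ((contDiff_norm_sq ℝ).add contDiff_const) fun y => by positivity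

theorem fderiv_invStereo (y w : E) : fderiv ℝ (invStereo J v) y w =
    (2 / (‖y‖ ^ 2 + 1)) • J w - (4 * ⟪y, w⟫ / (‖y‖ ^ 2 + 1) ^ 2) • (J y - v) := by
  have hs : ‖y‖ ^ 2 + 1 ≠ 0 := by positivity
  have h1 : HasFDerivAt (fun y : E => ‖y‖ ^ 2 + 1) (2 • innerSL ℝ y) y :=
    ((hasStrictFDerivAt_norm_sq y).hasFDerivAt).add_const 1
  have h2 : HasFDerivAt (fun y : E => 2 / (‖y‖ ^ 2 + 1))
      ((-(2 / (‖y‖ ^ 2 + 1) ^ 2)) • (2 • innerSL ℝ y)) y := by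
    have e : -(2 / (‖y‖ ^ 2 + 1) ^ 2) = 2 * -((‖y‖ ^ 2 + 1) ^ 2)⁻¹ := by ring
    rw [e]
    simp only [div_eq_mul_inv]
    have := ((hasDerivAt_inv hs).const_mul 2).comp_hasFDerivAt y h1
    exact this
  have h3 : HasFDerivAt (fun y : E => J y - v) J.toContinuousLinearMap y :=
    (J.toContinuousLinearMap.hasFDerivAt).sub_const v
  have h4 := (h2.smul h3).const_add v
  have h5 : fderiv ℝ (invStereo J v) y = _ := h4.fderiv
  rw [h5]
  change (2 / (‖y‖ ^ 2 + 1)) • J w + (-(2 / (‖y‖ ^ 2 + 1) ^ 2) * (2 • ⟪y, w⟫)) • (J y - v) = _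
  match_scalars <;> ring

theorem inner_fderiv_invStereo (hv : ‖v‖ = 1) (hJ : ∀ y, ⟪J y, v⟫ = 0) (y w w' : E) :
    ⟪fderiv ℝ (invStereo J v) y w, fderiv ℝ (invStereo J v) y w'⟫ =
      (2 / (‖y‖ ^ 2 + 1)) ^ 2 * ⟪w, w'⟫ := by
  have hs : ‖y‖ ^ 2 + 1 ≠ 0 := by positivity
  have hJ' : ∀ y, ⟪v, J y⟫ = 0 := fun y => by rw [real_inner_comm, hJ]
  rw [fderiv_invStereo, fderiv_invStereo]
  simp only [inner_sub_left, inner_sub_right,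
      real_inner_smul_left, real_inner_smul_right, hJ, hJ',
      J.inner_map_map, real_inner_self_eq_norm_sq, hv, real_inner_comm w y]
  rw [real_inner_comm y w]
  field_simp
  ring

theorem exists_invStereo_eq (hv : ‖v‖ = 1)
    (hsurj : ∀ u, ⟪u, v⟫ = 0 → ∃ y, J y = u) {x : G} (hx : ‖x‖ = 1) (ha : ⟪x, v⟫ ≤ 0) :
    ∃ y, ‖y‖ ≤ 1 ∧ invStereo J v y = x := by
  set a := ⟪x, v⟫ with ha'
  obtain ⟨u, hu⟩ := hsurj (x - a • v) (by
    rw [inner_sub_left, real_inner_smul_left, real_inner_self_eq_norm_sq, hv, ← ha']; ring)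
  have h1 : (1 - a) ≠ 0 := by linarith
  have hn : ‖u‖ ^ 2 = 1 - a ^ 2 := by
    rw [← J.norm_map, hu, norm_sub_sq_real, norm_smul, real_inner_smul_right, ← ha', hx, hv,
      Real.norm_eq_abs, mul_one, sq_abs]
    ring
  have hy : ‖(1 - a)⁻¹ • u‖ ^ 2 = (1 + a) / (1 - a) := by
    rw [norm_smul, mul_pow, hn, Real.norm_eq_abs, sq_abs]
    field_simp
    ring
  refine ⟨(1 - a)⁻¹ • u, ?_, ?_⟩
  · have : (1 + a) / (1 - a) ≤ 1 := by rw [div_le_one (by linarith)]; linarith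
    nlinarith [norm_nonneg ((1 - a)⁻¹ • u)]
  · have h2 : 2 / ((1 + a) / (1 - a) + 1) = 1 - a := by field_simp; ring
    rw [invStereo, hy, h2, map_smul, hu, smul_sub, smul_smul, mul_inv_cancel₀ h1]
    module

end stereo

theorem exists_conformal_chart (N : ℕ) : ∃ Φ : EucA N → EucA (N + 1), ContDiff ℝ (⊤ : ℕ∞) Φ ∧
    (∀ y, ‖Φ y‖ = 1) ∧
    (∀ y w w', ⟪fderiv ℝ Φ y w, fderiv ℝ Φ y w'⟫ = (2 / (‖y‖ ^ 2 + 1)) ^ 2 * ⟪w, w'⟫) ∧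
    ∀ x, ‖x‖ = 1 → ∃ y, ‖y‖ ≤ 1 ∧ (Φ y = x ∨ Φ y = -x) := by
  set v : EucA (N + 1) := EuclideanSpace.single 0 1
  have hv : ‖v‖ = 1 := by simp [v]
  have hv0 : v ≠ 0 := fun h => by simp [h] at hv
  have : Fact (Module.finrank ℝ (EucA (N + 1)) = N + 1) := ⟨by simp⟩
  set K := (OrthonormalBasis.fromOrthogonalSpanSingleton (𝕜 := ℝ) N hv0).repr.symm
  set J : EucA N →ₗᵢ[ℝ] EucA (N + 1) := (Submodule.subtypeₗᵢ _).comp K.toLinearIsometry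
  have hJ : ∀ y, ⟪J y, v⟫ = 0 := fun y => by
    rw [real_inner_comm]; exact Submodule.mem_orthogonal_singleton_iff_inner_right.1 (K y).2
  have hs : ∀ u, ⟪u, v⟫ = 0 → ∃ y, J y = u := fun u hu => by
    refine ⟨K.symm ⟨u, Submodule.mem_orthogonal_singleton_iff_inner_left.2 hu⟩, ?_⟩
    simp [J]
  refine ⟨invStereo J v, contDiff_invStereo, norm_invStereo hv hJ, inner_fderiv_invStereo hv hJ,
    fun x hx => ?_⟩
  rcases le_total ⟪x, v⟫ 0 with h | h
  · obtain ⟨y, hy, h⟩ := exists_invStereo_eq hv hs hx h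
    exact ⟨y, hy, Or.inl h⟩
  · obtain ⟨y, hy, h⟩ := exists_invStereo_eq hv hs (x := -x) (by simpa) (by simpa)
    exact ⟨y, hy, Or.inr h⟩

theorem norm_le_of_conformal {G E : Type*} [NormedAddCommGroup G] [InnerProductSpace ℝ G]
    [NormedAddCommGroup E] [InnerProductSpace ℝ E] {A : E →L[ℝ] G} {c : ℝ} (hc : 0 ≤ c)
    (h : ∀ w w', ⟪A w, A w'⟫ = c ^ 2 * ⟪w, w'⟫) : ‖A‖ ≤ c := by
  refine A.opNorm_le_bound hc fun w => ?_
  have := h w w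
  rw [real_inner_self_eq_norm_sq, real_inner_self_eq_norm_sq, ← mul_pow] at this
  exact (pow_le_pow_iff_left₀ (norm_nonneg _) (by positivity) two_ne_zero).1 this.le

theorem two_div_le_decay (r : ℝ) (hr : 0 ≤ r) :
    2 / (r ^ 2 + 1) ≤ 4 * (1 + r) ^ (-2 : ℝ) := by
  rw [Real.rpow_neg (by positivity), ← div_eq_mul_inv, div_le_div_iff₀ (by positivity)
    (by positivity)]
  norm_cast
  nlinarith [sq_nonneg (r - 1)]

theorem hausdorffMeasure_usph_lt_top (N : ℕ) : μH[(N : ℝ)] (usph (N + 1)) < ⊤ := by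
  obtain ⟨Φ, hΦ, h1, hconf, hcov⟩ := exists_conformal_chart N
  have hL : LipschitzWith 2 Φ := by
    refine lipschitzWith_of_nnnorm_fderiv_le (hΦ.differentiable (by simp)) fun y => ?_
    rw [← NNReal.coe_le_coe, coe_nnnorm]
    refine (norm_le_of_conformal (by positivity) (hconf y)).trans ?_
    rw [div_le_iff₀ (by positivity)]
    push_cast
    nlinarith [sq_nonneg ‖y‖]
  have hball : μH[(N : ℝ)] (Metric.closedBall (0 : EucA N) 1) < ⊤ := by
    have : (μH[(N : ℝ)] : Measure (EucA N)).IsAddHaarMeasure := by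
      have := MeasureTheory.isAddHaarMeasure_hausdorffMeasure (E := EucA N)
      simpa using this
    exact (isCompact_closedBall _ _).measure_lt_top
  have hsub : usph (N + 1) ⊆ Φ '' Metric.closedBall 0 1 ∪ (fun y => -Φ y) '' Metric.closedBall 0 1 := by
    intro x hx
    obtain ⟨y, hy, h | h⟩ := hcov x (by simpa [usph] using hx)
    · exact Or.inl ⟨y, by simpa using hy, h⟩
    · exact Or.inr ⟨y, by simpa using hy, by simp [h]⟩
  have key : ∀ f : EucA N → EucA (N + 1), LipschitzWith 2 f →
      μH[(N : ℝ)] (f '' Metric.closedBall 0 1) < ⊤ := fun f hf =>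
    (hf.hausdorffMeasure_image_le (by positivity) _).trans_lt
      (ENNReal.mul_lt_top (ENNReal.rpow_lt_top_of_nonneg (by positivity) (by simp)) hball)
  exact (measure_mono hsub).trans_lt ((measure_union_le _ _).trans_lt
    (ENNReal.add_lt_top.2 ⟨key _ hL, key _ hL.neg⟩))

theorem map_restrict_usph (d : ℕ) (ρ : ℝ) (R : EucA d ≃ₗᵢ[ℝ] EucA d) :
    (μH[ρ].restrict (usph d)).map R = μH[ρ].restrict (usph d) := by
  have h := (R.toIsometryEquiv.measurePreserving_hausdorffMeasure ρ).restrict_preimage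
    (s := usph d) Metric.isClosed_sphere.measurableSet
  have hp : R.toIsometryEquiv ⁻¹' usph d = usph d := by
    ext x; simp [usph]
  rw [hp] at h
  exact h.map_eq

/-- The determinant, as an alternating form on Euclidean space. -/
def detForm (d : ℕ) : EucA d [⋀^Fin d]→L[ℝ] ℝ :=
  toCAM d (EuclideanSpace.basisFun (Fin d) ℝ).toBasis.det

theorem detForm_apply {d : ℕ} (w : Fin d → EucA d) :
    detForm d w = (Matrix.of fun i j => w i j).det := by
  rw [detForm, toCAM_apply, Module.Basis.det_apply, ← Matrix.det_transpose]
  congr 1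

theorem detForm_single {d : ℕ} (σ : Equiv.Perm (Fin d)) :
    |detForm d fun i => EuclideanSpace.single (σ i) 1| = 1 := by
  have h := (detForm d).toAlternatingMap.map_perm (fun i => EuclideanSpace.single i (1 : ℝ)) σ
  have h1 : detForm d (fun i => EuclideanSpace.single i (1 : ℝ)) = 1 := by
    rw [detForm_apply, ← Matrix.det_one (n := Fin d)]
    congr 1
    ext i j
    simp [Matrix.one_apply, eq_comm]
  have h2 : detForm d (fun i => EuclideanSpace.single (σ i) (1 : ℝ)) =
      Equiv.Perm.sign σ • detForm d (fun i => EuclideanSpace.single i (1 : ℝ)) := h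
  rw [h2, h1]
  rcases Int.units_eq_one_or (Equiv.Perm.sign σ) with h | h <;> simp [h]

theorem volForm_detForm_sub_smul {k : ℕ} (x : EucA (k + 1)) (w : Fin k → EucA (k + 1))
    (c : Fin k → ℝ) : volForm (detForm (k + 1)) x (fun i => w i - c i • x) =
      volForm (detForm (k + 1)) x w := by
  rw [volForm_apply, volForm_apply, detForm_apply, detForm_apply]
  refine Matrix.det_eq_of_forall_row_eq_smul_add_const (Fin.cons 0 fun i => -c i) 0 (by simp)
    fun i j => ?_
  refine Fin.cases ?_ (fun i => ?_) i
  · simp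
  · simp [sub_eq_add_neg]

theorem detForm_single_sq {d : ℕ} (τ : Fin d → Fin d) :
    (detForm d fun i => EuclideanSpace.single (τ i) 1) ^ 2 =
      if Function.Injective τ then 1 else 0 := by
  split_ifs with h
  · have := detForm_single (Equiv.ofBijective τ (Finite.injective_iff_bijective.1 h))
    rw [← sq_abs]
    simp only [Equiv.ofBijective_apply] at this
    rw [this, one_pow]
  · have : detForm d (fun i => EuclideanSpace.single (τ i) (1 : ℝ)) = 0 :=
      (detForm d).toAlternatingMap.map_eq_zero_of_not_injective _ fun h' => h fun i j hij =>
        h' (by simp only [hij])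
    rw [this]
    norm_num

theorem mul_apply_eq_of_tangent {k : ℕ} {G : Type*} [NormedAddCommGroup G] [InnerProductSpace ℝ G]
    [FiniteDimensional ℝ G] (hG : Module.finrank ℝ G = k + 1)
    (α γ : AlternatingMap ℝ G ℝ (Fin k)) {x : G} (hx : x ≠ 0) {u v : Fin k → G}
    (hu : ∀ i, ⟪u i, x⟫ = 0) (hv : ∀ i, ⟪v i, x⟫ = 0) : α u * γ v = α v * γ u := by
  have : Fact (Module.finrank ℝ G = k + 1) := ⟨hG⟩
  set b := (OrthonormalBasis.fromOrthogonalSpanSingleton (𝕜 := ℝ) k hx).toBasis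
  have key : ∀ (δ : AlternatingMap ℝ G ℝ (Fin k)) (w : Fin k → G) (hw : ∀ i, ⟪w i, x⟫ = 0),
      δ w = δ (fun i => b i) * b.det fun i => ⟨w i,
        Submodule.mem_orthogonal_singleton_iff_inner_left.2 (hw i)⟩ := by
    intro δ w hw
    have := (δ.compLinearMap (ℝ ∙ x)ᗮ.subtype).eq_smul_basis_det b
    exact congrArg (fun f => f fun i => ⟨w i,
        Submodule.mem_orthogonal_singleton_iff_inner_left.2 (hw i)⟩) this
  rw [key α u hu, key α v hv, key γ u hu, key γ v hv]
  ring

/-- The sum of the squares of the frame components of the area form of the sphere. -/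
theorem exists_sum_volForm_sq (k : ℕ) : ∃ κ : ℝ, 0 < κ ∧ ∀ x : EucA (k + 1), ‖x‖ = 1 →
    ∑ σ : Fin k → Fin (k + 1),
      volForm (detForm (k + 1)) x (fun i => EuclideanSpace.single (σ i) 1) ^ 2 = κ := by
  set a : Fin (k + 1) → (Fin k → Fin (k + 1)) → ℝ := fun i σ =>
    detForm (k + 1) fun j => EuclideanSpace.single ((Fin.cons i σ : Fin (k + 1) → Fin (k + 1)) j) 1
  have hcons : ∀ (y : EucA (k + 1)) (i) (σ : Fin k → Fin (k + 1)),
      (fun j => EuclideanSpace.single ((Fin.cons i σ : Fin (k + 1) → Fin (k + 1)) j) (1 : ℝ)) =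
      Matrix.vecCons (EuclideanSpace.single i 1) fun j => EuclideanSpace.single (σ j) 1 := by
    intro y i σ
    ext j : 1
    refine Fin.cases ?_ (fun j => ?_) j <;> simp
  have ha : ∀ (x : EucA (k + 1)) σ, volForm (detForm (k + 1)) x
      (fun i => EuclideanSpace.single (σ i) 1) = ∑ i, x i * a i σ := by
    intro x σ
    conv_lhs => rw [← (EuclideanSpace.basisFun (Fin (k + 1)) ℝ).sum_repr x]
    simp only [map_sum, map_smul, ContinuousAlternatingMap.sum_apply,
      ContinuousAlternatingMap.smul_apply]
    refine Finset.sum_congr rfl fun i _ => ?_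
    rw [smul_eq_mul, volForm_apply]
    simp only [a, hcons x]
    simp
  have hsq : ∀ i σ, a i σ ^ 2 =
      if Function.Injective (Fin.cons i σ : Fin (k + 1) → Fin (k + 1)) then 1 else 0 :=
    fun i σ => detForm_single_sq _
  have h0 : ∀ i j σ, i ≠ j → a i σ * a j σ = 0 := by
    intro i j σ hij
    by_contra hne
    have hi : a i σ ^ 2 ≠ 0 := pow_ne_zero 2 (left_ne_zero_of_mul hne)
    have hj : a j σ ^ 2 ≠ 0 := pow_ne_zero 2 (right_ne_zero_of_mul hne)
    rw [hsq] at hi hj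
    simp only [ne_eq, ite_eq_right_iff, one_ne_zero, imp_false, not_not] at hi hj
    have hinj : Function.Injective (Fin.cons i (Fin.cons j σ : Fin (k + 1) → Fin (k + 1)) :
        Fin (k + 2) → Fin (k + 1)) := by
      refine Fin.cons_injective_iff.2 ⟨?_, hj⟩
      rintro ⟨l, hl⟩
      revert hl
      refine Fin.cases ?_ (fun l => ?_) l
      · intro hl; exact hij (by simpa using hl.symm)
      · intro hl; exact (Fin.cons_injective_iff.1 hi).1 ⟨l, by simpa using hl⟩
    have := Fintype.card_le_of_injective _ hinj
    simp at this
  have hind : ∀ i, ∑ σ, a i σ ^ 2 = ∑ σ, a 0 σ ^ 2 := by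
    intro i
    refine Fintype.sum_equiv ((Equiv.refl _).arrowCongr (Equiv.swap 0 i)) _ _ fun σ => ?_
    rw [hsq, hsq]
    have : (Fin.cons 0 (((Equiv.refl (Fin k)).arrowCongr (Equiv.swap 0 i)) σ) :
        Fin (k + 1) → Fin (k + 1)) = Equiv.swap 0 i ∘ (Fin.cons i σ : Fin (k + 1) → _) := by
      ext j : 1
      refine Fin.cases ?_ (fun j => ?_) j <;> simp
    simp only [this, (Equiv.swap 0 i).injective.of_comp_iff]
  refine ⟨∑ σ, a 0 σ ^ 2, ?_, fun x hx => ?_⟩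
  · refine Finset.sum_pos' (fun σ _ => sq_nonneg _) ⟨Fin.succ, Finset.mem_univ _, ?_⟩
    rw [hsq, if_pos]
    · norm_num
    · exact Fin.cons_injective_iff.2 ⟨by simp, Fin.succ_injective k⟩
  · have hstep : ∀ σ, (∑ i, x i * a i σ) ^ 2 = ∑ i, x i ^ 2 * a i σ ^ 2 := by
      intro σ
      rw [sq, Finset.sum_mul_sum]
      refine Finset.sum_congr rfl fun i _ => ?_
      rw [Finset.sum_eq_single i]
      · ring
      · intro j _ hj
        linear_combination x i * x j * h0 i j σ hj.symm
      · simp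
    simp only [ha, hstep]
    rw [Finset.sum_comm]
    simp only [← Finset.mul_sum, hind, ← Finset.sum_mul]
    rw [EuclideanSpace.norm_eq, Real.sqrt_eq_one] at hx
    simp only [Real.norm_eq_abs, sq_abs] at hx
    rw [hx, one_mul]

theorem inner_tproj {d : ℕ} {x : EucA d} (hx : ‖x‖ = 1) (v : EucA d) : ⟪tproj x v, x⟫ = 0 := by
  rw [tproj, inner_sub_left, real_inner_smul_left, real_inner_self_eq_norm_sq, hx]
  ring

theorem sphDensity_eq {k : ℕ} (α : (Fin k → EucA (k + 1)) → ℝ) (x : EucA (k + 1)) :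
    sphDensity rfl α x = ((k.factorial : ℕ) : ℝ)⁻¹ * ∑ σ : Fin k → Fin (k + 1),
      α (fun i => tproj x (EuclideanSpace.single (σ i) 1)) *
        volForm (detForm (k + 1)) x fun i => EuclideanSpace.single (σ i) 1 := by
  rw [sphDensity]
  congr 1
  refine Finset.sum_congr rfl fun σ _ => ?_
  congr 1
  have := volForm_detForm_sub_smul x (fun i => EuclideanSpace.single (σ i) (1 : ℝ))
    fun i => ⟪EuclideanSpace.single (σ i) (1 : ℝ), x⟫
  rw [← this, volForm_apply, detForm_apply]
  rfl

/-- A top-degree form on the sphere is its density times the area form, up to a constant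
depending only on the dimension. -/
theorem exists_apply_eq_sphDensity (k : ℕ) : ∃ c : ℝ, 0 < c ∧
    ∀ (α : AlternatingMap ℝ (EucA (k + 1)) ℝ (Fin k)) (x : EucA (k + 1)), ‖x‖ = 1 →
    ∀ v, (∀ i, ⟪v i, x⟫ = 0) →
      α v = c * sphDensity rfl (fun w => α w) x * volForm (detForm (k + 1)) x v := by
  obtain ⟨κ, hκ, h⟩ := exists_sum_volForm_sq k
  refine ⟨k.factorial / κ, by positivity, fun α x hx v hv => ?_⟩
  have hx0 : x ≠ 0 := fun h => by simp [h] at hx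
  have key : ∀ σ : Fin k → Fin (k + 1),
      α (fun i => tproj x (EuclideanSpace.single (σ i) 1)) *
        volForm (detForm (k + 1)) x (fun i => EuclideanSpace.single (σ i) 1) *
        volForm (detForm (k + 1)) x v =
      volForm (detForm (k + 1)) x (fun i => EuclideanSpace.single (σ i) 1) ^ 2 * α v := by
    intro σ
    have h1 := mul_apply_eq_of_tangent (by simp) α
      (volForm (detForm (k + 1)) x).toAlternatingMap hx0
      (u := fun i => tproj x (EuclideanSpace.single (σ i) 1)) (v := v)
      (fun i => inner_tproj hx _) hv
    have h2 : volForm (detForm (k + 1)) x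
        (fun i => tproj x (EuclideanSpace.single (σ i) (1 : ℝ))) = _ :=
      volForm_detForm_sub_smul x (fun i => EuclideanSpace.single (σ i) (1 : ℝ))
        fun i => ⟪EuclideanSpace.single (σ i) (1 : ℝ), x⟫
    simp only [ContinuousAlternatingMap.coe_toAlternatingMap] at h1
    rw [h2] at h1
    linear_combination volForm (detForm (k + 1)) x (fun i => EuclideanSpace.single (σ i) 1) * h1
  have h3 := Finset.sum_congr rfl fun σ (_ : σ ∈ Finset.univ) => key σ
  rw [← Finset.sum_mul, ← Finset.sum_mul, h x hx] at h3
  have hk : (k.factorial : ℝ) ≠ 0 := by positivity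
  rw [sphDensity_eq]
  field_simp
  linear_combination -h3

theorem contDiff_sphDensity {k : ℕ} {α : EucA (k + 1) → AlternatingMap ℝ (EucA (k + 1)) ℝ (Fin k)}
    (hα : ∀ v, ContDiff ℝ (⊤ : ℕ∞) fun x => α x v) :
    ContDiff ℝ (⊤ : ℕ∞) fun x => sphDensity rfl (fun w => α x w) x := by
  simp only [sphDensity_eq]
  refine contDiff_const.mul (ContDiff.sum fun σ _ => ContDiff.mul ?_ ?_)
  · refine (contDiff_toCAM hα).cam_apply (v := fun x i => tproj x (EuclideanSpace.single (σ i) 1))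
      fun i => ?_
    exact contDiff_const.sub ((contDiff_const.inner ℝ contDiff_id).smul contDiff_id)
  · exact (volForm (detForm (k + 1))).contDiff.cam_apply fun i => contDiff_const

section cone
variable {E : Type*} [NormedAddCommGroup E] [InnerProductSpace ℝ E] [FiniteDimensional ℝ E]

theorem continuous_fderiv_left {X : Type*} [NormedAddCommGroup X] [NormedSpace ℝ X]
    {g : E → ℝ → X} (hg : ContDiff ℝ (⊤ : ℕ∞) (Function.uncurry g)) :
    Continuous (Function.uncurry fun x t => fderiv ℝ (fun y => g y t) x) := by
  have h : ContDiff ℝ (⊤ : ℕ∞) (Function.uncurry fun (p : E × ℝ) y => g y p.2) :=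
    hg.comp (contDiff_snd.prodMk (contDiff_snd.comp contDiff_fst))
  exact (h.fderiv (contDiff_fst (n := (⊤ : ℕ∞))) (m := (⊤ : ℕ∞)) (by simp)).continuous

theorem hasFDerivAt_integral_zero_one {X : Type*} [NormedAddCommGroup X] [NormedSpace ℝ X]
    [CompleteSpace X] {g : E → ℝ → X} (hg : ContDiff ℝ (⊤ : ℕ∞) (Function.uncurry g)) (x : E) :
    HasFDerivAt (fun x => ∫ t in (0 : ℝ)..1, g x t)
      (∫ t in (0 : ℝ)..1, fderiv ℝ (fun y => g y t) x) x := by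
  have hF := continuous_fderiv_left hg
  obtain ⟨K, hK⟩ := ((isCompact_closedBall x 1).prod (isCompact_Icc (a := (0 : ℝ)) (b := 1))
    ).exists_bound_of_continuousOn hF.continuousOn
  refine intervalIntegral.hasFDerivAt_integral_of_dominated_of_fderiv_le
    (F' := fun x t => fderiv ℝ (fun y => g y t) x) (bound := fun _ => K)
    (Metric.closedBall_mem_nhds x one_pos) ?_ ?_ ?_ ?_ ?_ ?_
  · exact Filter.Eventually.of_forall fun y =>
      (hg.continuous.comp (Continuous.prodMk_right y)).aestronglyMeasurable
  · exact (hg.continuous.comp (Continuous.prodMk_right x)).intervalIntegrable _ _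
  · exact (hF.comp (Continuous.prodMk_right x)).aestronglyMeasurable
  · refine Filter.Eventually.of_forall fun t ht y hy => hK (y, t) ⟨hy, ?_⟩
    rw [uIoc_of_le zero_le_one] at ht
    exact ⟨ht.1.le, ht.2⟩
  · exact intervalIntegrable_const
  · exact Filter.Eventually.of_forall fun t _ y _ =>
      ((hg.comp (contDiff_id.prodMk contDiff_const)).differentiable (by simp) y).hasFDerivAt

theorem contDiff_integral_zero_one {X : Type*} [NormedAddCommGroup X] [NormedSpace ℝ X]
    [CompleteSpace X] {g : E → ℝ → X} (hg : ContDiff ℝ (⊤ : ℕ∞) (Function.uncurry g)) :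
    ContDiff ℝ 1 fun x => ∫ t in (0 : ℝ)..1, g x t := by
  have hF := continuous_fderiv_left hg
  rw [contDiff_one_iff_fderiv]
  refine ⟨fun x => (hasFDerivAt_integral_zero_one hg x).differentiableAt, ?_⟩
  rw [funext fun x => (hasFDerivAt_integral_zero_one hg x).fderiv]
  exact intervalIntegral.continuous_parametric_intervalIntegral_of_continuous' hF 0 1

variable {b : ℕ}

/-- Integrand of the homotopy operator of the Poincaré lemma. -/
def coneIntegrand (A : E → E [⋀^Fin (b + 1)]→L[ℝ] ℝ) (x : E) (t : ℝ) : E [⋀^Fin b]→L[ℝ] ℝ :=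
  t ^ b • (A (t • x)).curryLeft x

/-- Homotopy operator of the Poincaré lemma. -/
def conePrimitive (A : E → E [⋀^Fin (b + 1)]→L[ℝ] ℝ) (x : E) : E [⋀^Fin b]→L[ℝ] ℝ :=
  ∫ t in (0 : ℝ)..1, coneIntegrand A x t

variable {A : E → E [⋀^Fin (b + 1)]→L[ℝ] ℝ}

theorem contDiff_coneIntegrand (hA : ContDiff ℝ (⊤ : ℕ∞) A) :
    ContDiff ℝ (⊤ : ℕ∞) (Function.uncurry (coneIntegrand A)) := by
  refine contDiff_cam fun v => ?_
  have h := (hA.comp (contDiff_snd.smul contDiff_fst : ContDiff ℝ (⊤ : ℕ∞)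
    fun p : E × ℝ => p.2 • p.1)).cam_apply (v := fun p => Matrix.vecCons p.1 v) fun i => by
      refine Fin.cases ?_ (fun i => ?_) i
      · exact contDiff_fst
      · exact contDiff_const
  exact (contDiff_snd.pow b).mul h

theorem contDiff_conePrimitive (hA : ContDiff ℝ (⊤ : ℕ∞) A) : ContDiff ℝ 1 (conePrimitive A) :=
  contDiff_integral_zero_one (contDiff_coneIntegrand hA)

theorem fderiv_coneIntegrand (hA : ContDiff ℝ (⊤ : ℕ∞) A) (x w : E) (t : ℝ) (v : Fin b → E) :
    fderiv ℝ (fun y => coneIntegrand A y t) x w v =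
      t ^ b * (t * fderiv ℝ A (t • x) w (Matrix.vecCons x v) +
        A (t • x) (Matrix.vecCons w v)) := by
  have hd : DifferentiableAt ℝ (fun y => coneIntegrand A y t) x :=
    ((contDiff_coneIntegrand hA).comp (contDiff_id.prodMk contDiff_const)).differentiable
      (by simp) x
  rw [← fderiv_continuousAlternatingMap_apply_const_apply hd]
  have h1 : HasFDerivAt (fun y : E => t • y) (t • ContinuousLinearMap.id ℝ E) x :=
    (hasFDerivAt_id x).const_smul t
  have h2 : HasFDerivAt (fun y => A (t • y)) _ x :=
    (hA.differentiable (by simp) (t • x)).hasFDerivAt.comp x h1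
  have h3 : ∀ i : Fin (b + 1), HasFDerivAt (fun y : E => Matrix.vecCons y v i)
      (Fin.cons (α := fun _ => E →L[ℝ] E) (ContinuousLinearMap.id ℝ E) (fun _ => 0) i) x := by
    intro i
    refine Fin.cases ?_ (fun i => ?_) i
    · exact hasFDerivAt_id x
    · simpa using hasFDerivAt_const (v i) x
  have h4 := ((h2.continuousAlternatingMap_apply h3).const_mul (t ^ b)).fderiv
  have h5 : fderiv ℝ (fun y => coneIntegrand A y t v) x = _ := h4
  rw [h5]
  simp [Fin.sum_univ_succ]
  rw [show Function.update (fun j => Matrix.vecCons x v j) 0 w = Matrix.vecCons w v by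
    ext j : 1
    refine Fin.cases ?_ (fun j => ?_) j <;> simp]
  ring

theorem extDeriv_conePrimitive (hA : ContDiff ℝ (⊤ : ℕ∞) A) (hcl : ∀ x, extDeriv A x = 0) (x : E) :
    extDeriv (conePrimitive A) x = A x := by
  have hc := contDiff_coneIntegrand hA
  have hd : DifferentiableAt ℝ (conePrimitive A) x :=
    (contDiff_conePrimitive hA).differentiable (by simp) x
  have hdt : ∀ t, DifferentiableAt ℝ (fun y => coneIntegrand A y t) x := fun t =>
    (hc.comp (contDiff_id.prodMk contDiff_const)).differentiable (by simp) x
  have hcu : ∀ u : Fin b → E, ContDiff ℝ (⊤ : ℕ∞) (Function.uncurry fun x t =>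
      coneIntegrand A x t u) := fun u => hc.cam_apply fun _ => contDiff_const
  have hF : ∀ u : Fin b → E, Continuous fun t => fderiv ℝ (fun y => coneIntegrand A y t u) x :=
    fun u => (continuous_fderiv_left (hcu u)).comp (Continuous.prodMk_right x)
  have hev : ∀ (u : Fin b → E) w, Continuous fun t =>
      fderiv ℝ (fun y => coneIntegrand A y t) x w u := by
    intro u w
    simp_rw [← fderiv_continuousAlternatingMap_apply_const_apply (hdt _)]
    exact (hF u).clm_apply continuous_const
  have hint : ∀ u : Fin b → E, (fun x => conePrimitive A x u) =
      fun x => ∫ t in (0 : ℝ)..1, coneIntegrand A x t u := fun u => funext fun x =>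
    ((ContinuousAlternatingMap.apply ℝ E ℝ u).intervalIntegral_comp_comm
      ((hc.continuous.comp (Continuous.prodMk_right x)).intervalIntegrable 0 1)).symm
  ext v
  rw [extDeriv_apply_eq hd]
  have h1 : ∀ i : Fin (b + 1), fderiv ℝ (conePrimitive A) x (v i) (v ∘ i.succAbove) =
      ∫ t in (0 : ℝ)..1, fderiv ℝ (fun y => coneIntegrand A y t) x (v i) (v ∘ i.succAbove) := by
    intro i
    simp_rw [← fderiv_continuousAlternatingMap_apply_const_apply (hdt _)]
    rw [← fderiv_continuousAlternatingMap_apply_const_apply hd, hint,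
      (hasFDerivAt_integral_zero_one (hcu _) x).fderiv]
    exact ((ContinuousLinearMap.apply ℝ ℝ (v i)).intervalIntegral_comp_comm
      ((hF _).intervalIntegrable 0 1)).symm
  simp_rw [h1, ← intervalIntegral.integral_const_mul]
  rw [← intervalIntegral.integral_finsetSum fun i _ =>
    ((hev _ _).const_mul _).intervalIntegrable _ _]
  have h3 : ∀ t : ℝ, HasDerivAt (fun t : ℝ => t ^ (b + 1) * A (t • x) v)
      (∑ i : Fin (b + 1), (-1 : ℝ) ^ (i : ℕ) *
        fderiv ℝ (fun y => coneIntegrand A y t) x (v i) (v ∘ i.succAbove)) t := by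
    intro t
    have hx : HasDerivAt (fun t : ℝ => t • x) x t := by
      simpa using (hasDerivAt_id t).smul_const x
    have h4 : HasDerivAt (fun t : ℝ => A (t • x) v) (fderiv ℝ A (t • x) x v) t :=
      (ContinuousAlternatingMap.apply ℝ E ℝ v).hasFDerivAt.comp_hasDerivAt t
        ((hA.differentiable (by simp) (t • x)).hasFDerivAt.comp_hasDerivAt t hx)
    have h5 : ∑ i : Fin (b + 1), (-1 : ℝ) ^ (i : ℕ) *
        A (t • x) (Matrix.vecCons (v i) (v ∘ i.succAbove)) = (b + 1) * A (t • x) v := by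
      have := DFunLike.congr_fun
        (ContinuousAlternatingMap.alternatizeUncurryFin_curryLeft (A (t • x))) v
      rw [ContinuousAlternatingMap.alternatizeUncurryFin_apply] at this
      simp only [Int.reduceNeg, ContinuousAlternatingMap.curryLeft_apply_apply, zsmul_eq_mul,
        Int.cast_pow, Int.cast_neg, Int.cast_one, ContinuousAlternatingMap.smul_apply, nsmul_eq_mul,
        Nat.cast_add, Nat.cast_one] at this
      exact this
    have h6 : fderiv ℝ A (t • x) x v = ∑ i : Fin (b + 1), (-1 : ℝ) ^ (i : ℕ) *
        fderiv ℝ A (t • x) (v i) (Matrix.vecCons x (v ∘ i.succAbove)) := by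
      have := DFunLike.congr_fun (hcl (t • x)) (Matrix.vecCons x v)
      rw [extDeriv_apply_eq (hA.differentiable (by simp) _), Fin.sum_univ_succ] at this
      have e : ∀ i : Fin (b + 1), Matrix.vecCons x v ∘ i.succ.succAbove =
          Matrix.vecCons x (v ∘ i.succAbove) := by
        intro i
        ext j : 1
        refine Fin.cases ?_ (fun j => ?_) j <;> simp
      have e0 : Matrix.vecCons x v ∘ (0 : Fin (b + 2)).succAbove = v := by
        ext j : 1
        simp
      simp only [e, e0, Fin.val_zero, pow_zero, one_mul, Matrix.cons_val_zero, Fin.val_succ,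
        Matrix.cons_val_succ, pow_succ, mul_neg, mul_one, neg_mul, Finset.sum_neg_distrib] at this
      exact eq_of_sub_eq_zero (by simpa [sub_eq_add_neg] using this)
    have h7 := (hasDerivAt_pow (b + 1) t).mul h4
    refine h7.congr_deriv ?_
    simp only [fderiv_coneIntegrand hA]
    rw [h6]
    calc _ = t ^ b * ((b + 1) * A (t • x) v) + t ^ (b + 1) * ∑ i : Fin (b + 1), (-1 : ℝ) ^ (i : ℕ) *
        fderiv ℝ A (t • x) (v i) (Matrix.vecCons x (v ∘ i.succAbove)) := by push_cast; simp; ring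
      _ = _ := by
        rw [← h5, Finset.mul_sum, Finset.mul_sum, ← Finset.sum_add_distrib]
        refine Finset.sum_congr rfl fun i _ => ?_
        ring
  rw [intervalIntegral.integral_eq_sub_of_hasDerivAt (fun t _ => h3 t)]
  · simp
  · exact (continuous_finsetSum _ fun i _ => (hev _ _).const_mul _).intervalIntegrable _ _

theorem norm_conePrimitive_le {M : ℝ}
    (hM : ∀ y, ‖A y‖ ≤ M * (1 + ‖y‖) ^ (-(2 * ((b + 1 : ℕ) : ℝ)))) (y : E) :
    ‖conePrimitive A y‖ ≤ M * (1 + ‖y‖) ^ (-(b : ℝ)) := by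
  have hM0 : 0 ≤ M := by simpa using (norm_nonneg _).trans (hM 0)
  set r := ‖y‖ with hr
  have hr0 : 0 ≤ r := norm_nonneg y
  have hpos : ∀ t ∈ Icc (0 : ℝ) 1, 0 < 1 + t * r := fun t ht => by
    have := mul_nonneg ht.1 hr0; linarith
  have h1 : ∀ t ∈ Icc (0 : ℝ) 1, ‖coneIntegrand A y t‖ ≤
      M * (1 + r) ^ (-(b : ℝ)) * (r / (1 + t * r) ^ 2) := by
    intro t ht
    have hX := hpos t ht
    have hty : ‖t • y‖ = t * r := by rw [norm_smul, Real.norm_eq_abs, abs_of_nonneg ht.1]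
    have h3 : ‖coneIntegrand A y t‖ ≤ t ^ b * (‖A (t • y)‖ * r) := by
      rw [coneIntegrand, norm_smul, norm_pow, Real.norm_eq_abs, abs_of_nonneg ht.1]
      have := (A (t • y)).curryLeft.le_opNorm y
      rw [ContinuousAlternatingMap.norm_curryLeft] at this
      have := ht.1
      gcongr
    have h4 : t ^ b * (1 + r) ^ b ≤ (1 + t * r) ^ (2 * b) := by
      rw [← mul_pow]
      calc _ ≤ (1 + t * r) ^ b := by
            refine pow_le_pow_left₀ (mul_nonneg ht.1 (by linarith)) ?_ _
            linarith [ht.2]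
        _ ≤ _ := pow_le_pow_right₀ (by linarith [mul_nonneg ht.1 hr0]) (by omega)
    have h5 : (1 + t * r) ^ (-(2 * ((b + 1 : ℕ) : ℝ))) =
        ((1 + t * r) ^ (2 * b) * (1 + t * r) ^ 2)⁻¹ := by
      rw [Real.rpow_neg hX.le, ← pow_add]
      norm_cast
    have h6 : (1 + r) ^ (-(b : ℝ)) = ((1 + r) ^ b)⁻¹ := by
      rw [Real.rpow_neg (by positivity), Real.rpow_natCast]
    have h7 := hM (t • y)
    rw [hty, h5] at h7
    have ht0 := ht.1
    calc _ ≤ t ^ b * ((M * ((1 + t * r) ^ (2 * b) * (1 + t * r) ^ 2)⁻¹) * r) :=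
          h3.trans (by gcongr)
      _ = M * r * ((1 + t * r) ^ 2)⁻¹ * (t ^ b / (1 + t * r) ^ (2 * b)) := by
          rw [mul_inv]; ring
      _ ≤ M * r * ((1 + t * r) ^ 2)⁻¹ * ((1 + r) ^ b)⁻¹ := by
          gcongr
          rw [div_le_iff₀ (by positivity), inv_mul_eq_div, le_div_iff₀ (by positivity)]
          exact h4
      _ = _ := by rw [h6]; ring
  have hcont : ContinuousOn (fun t : ℝ => r / (1 + t * r) ^ 2) (uIcc 0 1) := by
    rw [uIcc_of_le zero_le_one]
    exact continuousOn_const.div (by fun_prop) fun t ht => pow_ne_zero 2 (hpos t ht).ne'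
  have h2 : ∫ t in (0 : ℝ)..1, r / (1 + t * r) ^ 2 = r / (1 + r) := by
    have hd : ∀ t ∈ uIcc (0 : ℝ) 1, HasDerivAt (fun t : ℝ => -(1 + t * r)⁻¹)
        (r / (1 + t * r) ^ 2) t := by
      intro t ht
      rw [uIcc_of_le zero_le_one] at ht
      have h := (((hasDerivAt_id t).mul_const r).const_add 1).fun_inv (hpos t ht).ne'
      refine h.fun_neg.congr_deriv ?_
      simp
      ring
    rw [intervalIntegral.integral_eq_sub_of_hasDerivAt hd hcont.intervalIntegrable]
    field_simp
    ring
  have hle : r / (1 + r) ≤ 1 := by rw [div_le_one (by positivity)]; linarith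
  calc ‖conePrimitive A y‖ ≤ ∫ t in (0 : ℝ)..1,
        M * (1 + r) ^ (-(b : ℝ)) * (r / (1 + t * r) ^ 2) :=
        intervalIntegral.norm_integral_le_of_norm_le zero_le_one
          (Filter.Eventually.of_forall fun t ht => h1 t ⟨ht.1.le, ht.2⟩)
          (hcont.const_mul _).intervalIntegrable
    _ ≤ _ := by
        rw [intervalIntegral.integral_const_mul, h2]
        exact mul_le_of_le_one_right (by positivity) hle

end cone

section dilation

theorem volForm_detForm_sq {m : ℕ} {x : EucA (m + 1)} (hx : ‖x‖ = 1) {u : Fin m → EucA (m + 1)}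
    (hu : ∀ i, ⟪u i, x⟫ = 0) :
    (volForm (detForm (m + 1)) x u) ^ 2 = (Matrix.of fun i j => ⟪u i, u j⟫).det := by
  rw [volForm_apply, detForm_apply, sq]
  nth_rewrite 2 [← Matrix.det_transpose]
  rw [← Matrix.det_mul]
  have h : (Matrix.of fun i j => (Matrix.vecCons x u i) j) *
      (Matrix.of fun i j => (Matrix.vecCons x u i) j).transpose =
      Matrix.of fun i j => ⟪(Matrix.vecCons x u : Fin (m + 1) → EucA (m + 1)) i,
        (Matrix.vecCons x u : Fin (m + 1) → EucA (m + 1)) j⟫ := by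
    ext i j
    simp [Matrix.mul_apply, PiLp.inner_apply, mul_comm]
  rw [h, Matrix.det_succ_row_zero, Fin.sum_univ_succ]
  have h0 : ∀ i, ⟪x, u i⟫ = 0 := fun i => by rw [real_inner_comm, hu]
  simp only [Matrix.of_apply, Matrix.cons_val_zero, Matrix.cons_val_succ,
    real_inner_self_eq_norm_sq, hx, h0]
  simp [Matrix.submatrix]

variable {E F : Type*} [NormedAddCommGroup E] [InnerProductSpace ℝ E]
  [NormedAddCommGroup F] [InnerProductSpace ℝ F]

theorem sqrt_det_gram_le {k : ℕ} {A : E →ₗ[ℝ] F} {M : ℝ} (hA : ∀ v, ‖A v‖ ≤ M * ‖v‖)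
    {v : Fin k → E} (hv : Orthonormal ℝ v) :
    Real.sqrt (Matrix.of fun (i j : Fin k) => ⟪A (v i), A (v j)⟫).det ≤
      Real.sqrt (k.factorial * (M * M) ^ k) := by
  refine Real.sqrt_le_sqrt ((le_abs_self _).trans ?_)
  have hM : ∀ i, ‖A (v i)‖ ≤ M := fun i => by simpa [hv.1 i] using hA (v i)
  have h := Matrix.det_le (A := Matrix.of fun (i j : Fin k) => ⟪A (v i), A (v j)⟫)
    (abv := AbsoluteValue.abs) (x := M * M) fun i j =>
      (abs_real_inner_le_norm _ _).trans (mul_le_mul (hM i) (hM j) (norm_nonneg _)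
        ((norm_nonneg _).trans (hM i)))
  simpa using h

theorem lamNorm_nonneg (k : ℕ) (A : E →ₗ[ℝ] F) : 0 ≤ lamNorm k A :=
  Real.iSup_nonneg fun _ => Real.sqrt_nonneg _

theorem lamNorm_le {k : ℕ} {A : E →ₗ[ℝ] F} {M : ℝ} (hA : ∀ v, ‖A v‖ ≤ M * ‖v‖) :
    lamNorm k A ≤ Real.sqrt (k.factorial * (M * M) ^ k) :=
  Real.iSup_le (fun v => sqrt_det_gram_le hA v.2) (Real.sqrt_nonneg _)

theorem sqrt_det_gram_le_lamNorm {k : ℕ} {A : E →ₗ[ℝ] F} {M : ℝ} (hA : ∀ v, ‖A v‖ ≤ M * ‖v‖)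
    {v : Fin k → E} (hv : Orthonormal ℝ v) :
    Real.sqrt (Matrix.of fun (i j : Fin k) => ⟪A (v i), A (v j)⟫).det ≤ lamNorm k A :=
  le_ciSup (f := fun v : {v : Fin k → E // Orthonormal ℝ v} =>
    Real.sqrt (Matrix.of fun (i j : Fin k) => ⟪A (v.1 i), A (v.1 j)⟫).det)
    ⟨_, forall_mem_range.2 fun v => sqrt_det_gram_le hA v.2⟩ ⟨v, hv⟩

theorem kDilation_nonneg {d : ℕ} (k : ℕ) (f : EucA d → F) : 0 ≤ kDilation k f :=
  Real.iSup_nonneg fun _ => lamNorm_nonneg _ _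

theorem exists_norm_fderiv_le {d : ℕ} {f : EucA d → F} (hf : ContDiff ℝ (⊤ : ℕ∞) f) :
    ∃ M, ∀ x, ‖x‖ = 1 → ‖fderiv ℝ f x‖ ≤ M := by
  obtain ⟨M, hM⟩ := (isCompact_sphere (0 : EucA d) 1).exists_bound_of_continuousOn
    (hf.continuous_fderiv (by simp)).continuousOn
  exact ⟨M, fun x hx => hM x (by simpa using hx)⟩

theorem sqrt_det_gram_le_kDilation {d k : ℕ} {f : EucA d → F} (hf : ContDiff ℝ (⊤ : ℕ∞) f)
    {x : EucA d} (hx : ‖x‖ = 1) {v : Fin k → EucA d} (hv : Orthonormal ℝ v)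
    (hvx : ∀ i, ⟪v i, x⟫ = 0) :
    Real.sqrt (Matrix.of fun (i j : Fin k) => ⟪fderiv ℝ f x (v i), fderiv ℝ f x (v j)⟫).det ≤
      kDilation k f := by
  obtain ⟨M, hM⟩ := exists_norm_fderiv_le hf
  have hA : ∀ y : usph d, ∀ w : (ℝ ∙ (y : EucA d))ᗮ,
      ‖((fderiv ℝ f (y : EucA d)).toLinearMap ∘ₗ ((ℝ ∙ (y : EucA d))ᗮ).subtype) w‖ ≤
        M * ‖w‖ := fun y w =>
    (fderiv ℝ f (y : EucA d)).le_of_opNorm_le (hM y (by simpa [usph] using y.2)) w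
  let x' : usph d := ⟨x, by simpa [usph] using hx⟩
  let v' : Fin k → (ℝ ∙ (x' : EucA d))ᗮ := fun i =>
    ⟨v i, Submodule.mem_orthogonal_singleton_iff_inner_left.2 (hvx i)⟩
  have hv' : Orthonormal ℝ v' := by
    rw [← ((ℝ ∙ (x' : EucA d))ᗮ).subtypeₗᵢ.orthonormal_comp_iff]
    exact hv
  refine (sqrt_det_gram_le_lamNorm (hA x') hv').trans ?_
  exact le_ciSup (f := fun y : usph d => lamNorm k
    ((fderiv ℝ f (y : EucA d)).toLinearMap ∘ₗ ((ℝ ∙ (y : EucA d))ᗮ).subtype))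
    ⟨_, forall_mem_range.2 fun y => lamNorm_le (hA y)⟩ x'

variable {N m : ℕ} {Φ : EucA N → EucA (N + 1)} {f : EucA (N + 1) → EucA (m + 1)}

theorem norm_pb_volForm_le (hΦ : ContDiff ℝ (⊤ : ℕ∞) Φ) (h1 : ∀ y, ‖Φ y‖ = 1)
    (hconf : ∀ y w w', ⟪fderiv ℝ Φ y w, fderiv ℝ Φ y w'⟫ = (2 / (‖y‖ ^ 2 + 1)) ^ 2 * ⟪w, w'⟫)
    (hf : ContDiff ℝ (⊤ : ℕ∞) f) (hf1 : ∀ x, ‖x‖ = 1 → ‖f x‖ = 1) (y : EucA N) :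
    ‖pb (f ∘ Φ) (fun z => volForm (detForm (m + 1)) z) y‖ ≤
      (N ^ m * 4 ^ m * kDilation m f) * (1 + ‖y‖) ^ (-(2 * (m : ℝ))) := by
  set c := 2 / (‖y‖ ^ 2 + 1) with hc
  have hc0 : 0 < c := by positivity
  have hh : ContDiff ℝ (⊤ : ℕ∞) (f ∘ Φ) := hf.comp hΦ
  have hd : ∀ w, fderiv ℝ (f ∘ Φ) y w = fderiv ℝ f (Φ y) (fderiv ℝ Φ y w) := fun w => by
    rw [fderiv_comp _ (hf.differentiable (by simp) _) (hΦ.differentiable (by simp) _)]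
    rfl
  have hframe : ∀ σ : Fin m → Fin N, |pb (f ∘ Φ) (fun z => volForm (detForm (m + 1)) z) y
      (fun i => EuclideanSpace.basisFun (Fin N) ℝ (σ i))| ≤ kDilation m f * c ^ m := by
    intro σ
    set e := EuclideanSpace.basisFun (Fin N) ℝ
    by_cases hσ : Function.Injective σ
    · let w : Fin m → EucA (N + 1) := fun i => c⁻¹ • fderiv ℝ Φ y (e (σ i))
      have hw : Orthonormal ℝ w := by
        rw [orthonormal_iff_ite]
        intro i j
        simp only [w, inner_smul_left, inner_smul_right, hconf, ← hc]
        rw [orthonormal_iff_ite.1 e.orthonormal]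
        simp only [hσ.eq_iff]
        split_ifs
        · simp; field_simp
        · simp
      have hwx : ∀ i, ⟪w i, Φ y⟫ = 0 := fun i => by
        simp only [w, inner_smul_left]
        rw [inner_fderiv_eq_zero hΦ h1, mul_zero]
      have hde : ∀ i, fderiv ℝ (f ∘ Φ) y (e (σ i)) = c • fderiv ℝ f (Φ y) (w i) := fun i => by
        rw [hd]
        simp only [w, map_smul]
        rw [smul_inv_smul₀ hc0.ne']
      have hperp : ∀ i, ⟪fderiv ℝ f (Φ y) (w i), f (Φ y)⟫ = 0 := fun i => by
        have := inner_fderiv_eq_zero hh (fun y => hf1 _ (h1 y)) y (c⁻¹ • e (σ i))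
        rw [hd, map_smul] at this
        exact this
      have hV : |volForm (detForm (m + 1)) (f (Φ y)) fun i => fderiv ℝ f (Φ y) (w i)| ≤
          kDilation m f := by
        rw [← Real.sqrt_sq_eq_abs, volForm_detForm_sq (hf1 _ (h1 y)) hperp]
        exact sqrt_det_gram_le_kDilation hf (h1 y) hw hwx
      rw [pb_apply]
      simp only [hde]
      rw [Function.comp_apply, ContinuousAlternatingMap.map_smul_univ]
      simp only [Finset.prod_const, Finset.card_univ, Fintype.card_fin, smul_eq_mul]
      rw [abs_mul, abs_of_pos (by positivity), mul_comm]
      gcongr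
    · have h0 : pb (f ∘ Φ) (fun z => volForm (detForm (m + 1)) z) y (fun i => e (σ i)) = 0 := by
        simp only [Function.Injective, not_forall] at hσ
        obtain ⟨i, j, hij, hne⟩ := hσ
        exact ContinuousAlternatingMap.map_eq_zero_of_eq _ _ (by simp [hij]) hne
      rw [h0, abs_zero]
      exact mul_nonneg (kDilation_nonneg _ _) (by positivity)
  have hD := kDilation_nonneg m f
  refine (norm_le_of_frame_le (EuclideanSpace.basisFun (Fin N) ℝ) _ (by positivity) hframe).trans ?_
  have h2 : c ^ m ≤ 4 ^ m * (1 + ‖y‖) ^ (-(2 * (m : ℝ))) := by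
    refine (pow_le_pow_left₀ hc0.le (two_div_le_decay _ (norm_nonneg y)) m).trans_eq ?_
    rw [mul_pow, ← Real.rpow_natCast (_ ^ (-2 : ℝ)), ← Real.rpow_mul (by positivity)]
    ring_nf
  simp only [Fintype.card_fin]
  calc _ ≤ (N : ℝ) ^ m * (kDilation m f * (4 ^ m * (1 + ‖y‖) ^ (-(2 * (m : ℝ))))) := by gcongr
    _ = _ := by ring

end dilation

section chart

theorem wedgeEval_zero_left {E : Type*} [AddCommGroup E] [Module ℝ E] {q : ℕ}
    (β : AlternatingMap ℝ E ℝ (Fin q)) (v : Fin (0 + q) → E) :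
    wedgeEval 0 q (fun _ => 1) β v = β (v ∘ Fin.natAdd 0) := by
  let ψ : Fin q ≃ Fin (0 + q) := finCongr (zero_add q).symm
  have hψ : ∀ j, Fin.natAdd 0 j = ψ j := fun j => by ext; simp [ψ]
  have h : ∀ σ : Equiv.Perm (Fin (0 + q)), ((Equiv.Perm.sign σ : ℤ) : ℝ) *
      (1 * β fun j => v (σ (Fin.natAdd 0 j))) = β (v ∘ Fin.natAdd 0) := by
    intro σ
    have h1 : (fun j => v (σ (Fin.natAdd 0 j))) =
        (v ∘ Fin.natAdd 0) ∘ (ψ.symm.permCongr σ : Equiv.Perm (Fin q)) := by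
      ext j : 1
      rw [Function.comp_apply, Function.comp_apply, hψ, hψ, Equiv.permCongr_apply,
        Equiv.symm_symm, Equiv.apply_symm_apply]
    rw [h1, β.map_perm, Equiv.Perm.sign_permCongr, one_mul]
    rcases Int.units_eq_one_or (Equiv.Perm.sign σ) with h | h <;> simp [h]
  have hq : ((0 + q).factorial : ℝ) ≠ 0 := by exact_mod_cast (Nat.factorial_pos _).ne'
  rw [wedgeEval, Finset.sum_congr rfl fun σ _ => h σ]
  simp only [Finset.sum_const, Finset.card_univ, Fintype.card_perm, Fintype.card_fin,
    nsmul_eq_mul, Nat.factorial_zero, one_mul]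
  have h0 : ((0 + q).factorial : ℝ) = q.factorial := by rw [zero_add]
  rw [h0] at hq ⊢
  field_simp

theorem integral_ne_zero_of_continuous {E : Type*} [NormedAddCommGroup E] [InnerProductSpace ℝ E]
    [FiniteDimensional ℝ E] [MeasurableSpace E] [BorelSpace E] {J : E → ℝ} (hJs : Continuous J)
    (hint : Integrable J) (hJ0 : ∀ y, J y ≠ 0) : ∫ y, J y ≠ 0 := by
  have hsupp : Function.support J = univ := by ext y; simp [hJ0 y]
  have hsign : (∀ y, 0 < J y) ∨ ∀ y, 0 < -J y := by
    by_contra! hcon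
    obtain ⟨⟨a, ha⟩, c, hc⟩ := hcon
    obtain ⟨z, hz⟩ := mem_range_of_exists_le_of_exists_ge hJs ⟨a, ha⟩ ⟨c, by linarith⟩
    exact hJ0 z hz
  rcases hsign with h | h
  · refine ((integral_pos_iff_support_of_nonneg (fun y => (h y).le) hint).2 ?_).ne'
    rw [hsupp]; exact Measure.measure_univ_pos.2 (NeZero.ne _)
  · have := (integral_pos_iff_support_of_nonneg (f := -J) (fun y => (h y).le) hint.neg).2 (by
      rw [Function.support_neg, hsupp]; exact Measure.measure_univ_pos.2 (NeZero.ne _))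
    simp only [Pi.neg_apply, integral_neg] at this
    intro h0
    rw [h0] at this
    simp at this

variable {N : ℕ} {Φ : EucA N → EucA (N + 1)}

theorem norm_fderiv_chart_le
    (hconf : ∀ y w w', ⟪fderiv ℝ Φ y w, fderiv ℝ Φ y w'⟫ = (2 / (‖y‖ ^ 2 + 1)) ^ 2 * ⟪w, w'⟫)
    (y : EucA N) : ‖fderiv ℝ Φ y‖ ≤ 4 * (1 + ‖y‖) ^ (-2 : ℝ) :=
  (norm_le_of_conformal (by positivity) (hconf y)).trans (two_div_le_decay _ (norm_nonneg y))

theorem integral_jacobian_ne_zero (hN : 1 ≤ N) (hΦ : ContDiff ℝ (⊤ : ℕ∞) Φ) (h1 : ∀ y, ‖Φ y‖ = 1)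
    (hconf : ∀ y w w', ⟪fderiv ℝ Φ y w, fderiv ℝ Φ y w'⟫ = (2 / (‖y‖ ^ 2 + 1)) ^ 2 * ⟪w, w'⟫) :
    ∫ y, pb Φ (fun z => volForm (detForm (N + 1)) z) y
      (fun i => EuclideanSpace.basisFun (Fin N) ℝ i) ≠ 0 := by
  have hs : ContDiff ℝ (⊤ : ℕ∞) (pb Φ fun z => volForm (detForm (N + 1)) z) :=
    contDiff_pb hΦ (volForm (detForm (N + 1))).contDiff
  have hc : Continuous fun y => pb Φ (fun z => volForm (detForm (N + 1)) z) y
      (fun i => EuclideanSpace.basisFun (Fin N) ℝ i) :=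
    (hs.cam_apply (v := fun _ i => EuclideanSpace.basisFun (Fin N) ℝ i)
      fun _ => contDiff_const).continuous
  refine integral_ne_zero_of_continuous hc ?_ ?_
  · have hd := norm_pb_le_decay (norm_fderiv_chart_le hconf)
      (fun z => volForm (detForm (N + 1)) z) (M := ‖volForm (detForm (N + 1))‖)
      fun y => norm_volForm_le _ (h1 y)
    refine integrable_of_decay hc (C := ‖volForm (detForm (N + 1))‖ * 4 ^ N) (r := 2 * N) ?_ fun y => ?_
    rotate_left
    · refine LE.le.trans ?_ (hd y)
      have := (pb Φ (fun z => volForm (detForm (N + 1)) z) y).le_opNorm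
        (fun i => EuclideanSpace.basisFun (Fin N) ℝ i)
      simpa using this
    · have : (1 : ℝ) ≤ N := by exact_mod_cast hN
      simp
      linarith
  · intro y h
    have h2 := volForm_detForm_sq (h1 y)
      (u := fun i => fderiv ℝ Φ y (EuclideanSpace.basisFun (Fin N) ℝ i))
      fun i => inner_fderiv_eq_zero hΦ h1 y _
    have h3 : (Matrix.of fun i j => ⟪fderiv ℝ Φ y (EuclideanSpace.basisFun (Fin N) ℝ i),
        fderiv ℝ Φ y (EuclideanSpace.basisFun (Fin N) ℝ j)⟫) =
        ((2 / (‖y‖ ^ 2 + 1)) ^ 2) • (1 : Matrix (Fin N) (Fin N) ℝ) := by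
      ext i j
      simp only [Matrix.of_apply, hconf, Matrix.smul_apply, smul_eq_mul, Matrix.one_apply]
      rw [orthonormal_iff_ite.1 (EuclideanSpace.basisFun (Fin N) ℝ).orthonormal]
    rw [h3, Matrix.det_smul, Matrix.det_one] at h2
    rw [pb_apply] at h
    rw [h] at h2
    have : (0 : ℝ) < ((2 / (‖y‖ ^ 2 + 1)) ^ 2) ^ Fintype.card (Fin N) * 1 := by positivity
    rw [← h2] at this
    simp at this

theorem exists_sphereFormIntegral_eq (hN : 2 ≤ N) (hΦ : ContDiff ℝ (⊤ : ℕ∞) Φ)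
    (h1 : ∀ y, ‖Φ y‖ = 1)
    (hconf : ∀ y w w', ⟪fderiv ℝ Φ y w, fderiv ℝ Φ y w'⟫ = (2 / (‖y‖ ^ 2 + 1)) ^ 2 * ⟪w, w'⟫) :
    ∃ c : ℝ, ∀ α : EucA (N + 1) → AlternatingMap ℝ (EucA (N + 1)) ℝ (Fin N),
      (∀ v, ContDiff ℝ (⊤ : ℕ∞) fun x => α x v) →
      sphereFormIntegral rfl (N : ℝ) (fun x v => α x v) =
        c * ∫ y, α (Φ y) fun i => fderiv ℝ Φ y (EuclideanSpace.basisFun (Fin N) ℝ i) := by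
  obtain ⟨k, rfl⟩ : ∃ k, N = k + 1 := ⟨N - 1, by omega⟩
  obtain ⟨c, hc, hα⟩ := exists_apply_eq_sphDensity (k + 1)
  set e := EuclideanSpace.basisFun (Fin (k + 1)) ℝ
  set J := ∫ y, pb Φ (fun z => volForm (detForm (k + 2)) z) y (fun i => e i) with hJ
  have hJ0 : J ≠ 0 := integral_jacobian_ne_zero (by omega) hΦ h1 hconf
  let μ : Measure (EucA (k + 1 + 1)) := μH[((k + 1 : ℕ) : ℝ)].restrict (usph (k + 1 + 1))
  have hfin : IsFiniteMeasure μ := ⟨by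
    rw [Measure.restrict_apply_univ]; exact hausdorffMeasure_usph_lt_top (k + 1)⟩
  refine ⟨μ.real univ / (c * J), fun α hαs => ?_⟩
  set φ := fun x => sphDensity rfl (fun w => α x w) x with hφ
  have hφc : Continuous φ := (contDiff_sphDensity hαs).continuous
  obtain ⟨B, hB⟩ := (isCompact_sphere (0 : EucA (k + 1 + 1)) 1).exists_bound_of_continuousOn
    hφc.continuousOn
  have hI := invariant_integral (p := 0) (k := k) (E := EucA (k + 1)) (by omega) (by simp)
    (by simp; omega) (detForm (k + 2)) hΦ h1 (norm_fderiv_chart_le hconf)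
    (γ := fun _ => ContinuousAlternatingMap.constOfIsEmpty ℝ (EucA (k + 1)) (Fin 0) 1)
    contDiff_const (A := ‖ContinuousAlternatingMap.constOfIsEmpty ℝ (EucA (k + 1)) (Fin 0)
      (1 : ℝ)‖) (by simp) (e := fun i => e (Fin.cast (by omega) i)) (by simp [e])
    (by
      intro η y
      have : extDeriv (fun _ : EucA (k + 1) =>
          ContinuousAlternatingMap.constOfIsEmpty ℝ (EucA (k + 1)) (Fin 0) (1 : ℝ)) y = 0 := by
        ext v
        rw [extDeriv_apply_eq (by fun_prop)]
        simp
      rw [this]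
      simp [wedgeEval])
    (μ := μ) (by
      filter_upwards [ae_restrict_mem Metric.isClosed_sphere.measurableSet] with x hx
      simpa [usph] using hx)
    (map_restrict_usph _ _) hφc.measurable (B := B) (fun x hx => hB x (by simpa using hx))
  have hw : ∀ y, wedgeEval 0 (k + 1)
      (ContinuousAlternatingMap.constOfIsEmpty ℝ (EucA (k + 1)) (Fin 0) (1 : ℝ))
      (pb Φ (fun z => volForm (detForm (k + 2)) z) y)
      ((fun i : Fin (0 + 1 + k) => e (Fin.cast (by omega) i)) ∘ Fin.cast (by omega)) =
      pb Φ (fun z => volForm (detForm (k + 2)) z) y (fun i => e i) := by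
    intro y
    refine (wedgeEval_zero_left
      (pb Φ (fun z => volForm (detForm (k + 2)) z) y).toAlternatingMap _).trans ?_
    refine congrArg (pb Φ (fun z => volForm (detForm (k + 2)) z) y) ?_
    ext i : 1
    simp only [Function.comp_apply]
    congr 1
    ext
    simp
  simp only [hw] at hI
  have h2 : ∀ y, α (Φ y) (fun i => fderiv ℝ Φ y (e i)) =
      c * (φ (Φ y) * pb Φ (fun z => volForm (detForm (k + 2)) z) y (fun i => e i)) := by
    intro y
    rw [hα (α (Φ y)) (Φ y) (h1 y) _ fun i => inner_fderiv_eq_zero hΦ h1 y _, mul_assoc]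
    rfl
  have h3 : sphereFormIntegral rfl ((k + 1 : ℕ) : ℝ) (fun x v => α x v) = ∫ x, φ x ∂μ := rfl
  simp only [h2]
  rw [integral_const_mul, h3]
  rw [← hJ] at hI
  field_simp
  linarith

end chart

section hopf

theorem wedgeEval_pb_eq_zero {E G : Type*} [NormedAddCommGroup E] [InnerProductSpace ℝ E]
    [FiniteDimensional ℝ E] [NormedAddCommGroup G] [InnerProductSpace ℝ G] [FiniteDimensional ℝ G]
    {p q : ℕ} {h : E → G} (hh : ContDiff ℝ (⊤ : ℕ∞) h) (h1 : ∀ y, ‖h y‖ = 1)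
    (hpq : Module.finrank ℝ G ≤ p + q) (ξ : G → G [⋀^Fin p]→L[ℝ] ℝ) (η : G → G [⋀^Fin q]→L[ℝ] ℝ)
    (y : E) (v : Fin (p + q) → E) : wedgeEval p q (pb h ξ y) (pb h η y) v = 0 := by
  have h0 : h y ≠ 0 := fun h0 => by have := h1 y; simp [h0] at this
  have := alternatingMap_eq_zero_of_orthogonal
    (wedgeAlt p q (ξ (h y)).toAlternatingMap (η (h y)).toAlternatingMap) h0 hpq
    (fun i => fderiv ℝ h y (v i)) fun i => inner_fderiv_eq_zero hh h1 y _
  rw [wedgeAlt_apply] at this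
  exact this

theorem exists_integral_wedge_pb_eq (b : ℕ) (hb : 1 ≤ b) : ∃ c : ℝ, 0 < c ∧
    ∀ {h : EucA (b + (b + 1)) → EucA (b + 1 + 1)}, ContDiff ℝ (⊤ : ℕ∞) h → (∀ y, ‖h y‖ = 1) →
    ∀ {C : ℝ}, (∀ y, ‖fderiv ℝ h y‖ ≤ C * (1 + ‖y‖) ^ (-2 : ℝ)) →
    ∀ {γ : EucA (b + (b + 1)) → EucA (b + (b + 1)) [⋀^Fin b]→L[ℝ] ℝ}, ContDiff ℝ 1 γ →
    ∀ {A : ℝ}, (∀ y, ‖γ y‖ ≤ A * (1 + ‖y‖) ^ (-(b : ℝ))) →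
    ∀ {ξ : EucA (b + 1 + 1) → EucA (b + 1 + 1) [⋀^Fin (b + 1)]→L[ℝ] ℝ},
      (∀ y, extDeriv γ y = pb h ξ y) →
    ∀ {ω : EucA (b + 1 + 1) → AlternatingMap ℝ (EucA (b + 1 + 1)) ℝ (Fin (b + 1))},
      (∀ v, ContDiff ℝ (⊤ : ℕ∞) fun x => ω x v) →
      (μH[((b + 1 : ℕ) : ℝ)].restrict (usph (b + 1 + 1))).real univ *
        ∫ y, wedgeEval b (b + 1) (γ y) (pb h (fun z => toCAM (b + 1) (ω z)) y)
          (fun i => EuclideanSpace.basisFun (Fin (b + (b + 1))) ℝ i) =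
      c * sphereFormIntegral rfl ((b + 1 : ℕ) : ℝ) (fun x v => ω x v) *
        ∫ y, wedgeEval b (b + 1) (γ y) (pb h (fun z => volForm (detForm (b + 1 + 1)) z) y)
          (fun i => EuclideanSpace.basisFun (Fin (b + (b + 1))) ℝ i) := by
  obtain ⟨c, hc, hω⟩ := exists_apply_eq_sphDensity (b + 1)
  refine ⟨c, hc, ?_⟩
  intro h hh h1 C hdec γ hγ A hA ξ hξ ω hωs
  let e := EuclideanSpace.basisFun (Fin (b + (b + 1))) ℝ
  let μ : Measure (EucA (b + 1 + 1)) := μH[((b + 1 : ℕ) : ℝ)].restrict (usph (b + 1 + 1))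
  have hfin : IsFiniteMeasure μ := ⟨by
    rw [Measure.restrict_apply_univ]; exact hausdorffMeasure_usph_lt_top (b + 1)⟩
  set φ := fun x => sphDensity rfl (fun w => ω x w) x with hφ
  have hφc : Continuous φ := (contDiff_sphDensity hωs).continuous
  obtain ⟨B, hB⟩ := (isCompact_sphere (0 : EucA (b + 1 + 1)) 1).exists_bound_of_continuousOn
    hφc.continuousOn
  have hI := invariant_integral (p := b) (k := b) hb (by simp) (by simp; omega)
    (detForm (b + 2)) hh h1 hdec hγ hA
    (e := fun i => e (Fin.cast (by omega) i)) (by simp [e])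
    (fun η y => by
      rw [hξ]
      exact wedgeEval_pb_eq_zero hh h1 (by simp; omega) _ _ _ _)
    (μ := μ) (by
      filter_upwards [ae_restrict_mem Metric.isClosed_sphere.measurableSet] with x hx
      simpa [usph] using hx)
    (map_restrict_usph _ _) hφc.measurable (B := B) (fun x hx => hB x (by simpa using hx))
  have he : (fun i : Fin (b + 1 + b) => e (Fin.cast (by omega) i)) ∘ Fin.cast (by omega) =
      fun i => e i := rfl
  rw [he] at hI
  have h2 : ∀ y, wedgeEval b (b + 1) (γ y) (pb h (fun z => toCAM (b + 1) (ω z)) y)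
      (fun i => e i) = c * (φ (h y) * wedgeEval b (b + 1) (γ y)
        (pb h (fun z => volForm (detForm (b + 2)) z) y) fun i => e i) := by
    intro y
    have h3 : ((pb h (fun z => toCAM (b + 1) (ω z)) y : _ → ℝ)) =
        fun w => (c * φ (h y)) * pb h (fun z => volForm (detForm (b + 2)) z) y w := by
      ext w
      exact hω (ω (h y)) (h y) (h1 y) _ fun i => inner_fderiv_eq_zero hh h1 y _
    rw [h3, wedgeEval_smul_right, mul_assoc]
  have h3 : sphereFormIntegral rfl ((b + 1 : ℕ) : ℝ) (fun x v => ω x v) = ∫ x, φ x ∂μ := rfl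
  have h4 : (∫ y, wedgeEval b (b + 1) (γ y) (pb h (fun z => toCAM (b + 1) (ω z)) y)
      (fun i => e i)) = c * ∫ y, φ (h y) * wedgeEval b (b + 1) (γ y)
        (pb h (fun z => volForm (detForm (b + 2)) z) y) fun i => e i := by
    rw [← integral_const_mul]
    exact integral_congr_ae (Filter.Eventually.of_forall h2)
  rw [h3]
  refine (congrArg (μ.real univ * ·) h4).trans ?_
  calc _ = c * (μ.real univ * ∫ y, φ (h y) * wedgeEval b (b + 1) (γ y)
        (pb h (fun z => volForm (detForm (b + 2)) z) y) fun i => e i) := by ring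
    _ = _ := by rw [hI]; ring

end hopf

section core

theorem extDeriv_pb_toCAM {N m b : ℕ} {Φ : EucA N → EucA (N + 1)} (hΦ : ContDiff ℝ (⊤ : ℕ∞) Φ)
    (h1 : ∀ y, ‖Φ y‖ = 1) {F : EucA (N + 1) → EucA m} (hF : ContDiff ℝ (⊤ : ℕ∞) F)
    {ω : EucA m → AlternatingMap ℝ (EucA m) ℝ (Fin (b + 1))}
    {β : EucA (N + 1) → AlternatingMap ℝ (EucA (N + 1)) ℝ (Fin b)}
    (hβ : ∀ v, ContDiff ℝ (⊤ : ℕ∞) fun x => β x v)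
    (hβω : ∀ x, ‖x‖ = 1 → ∀ v : Fin (b + 1) → EucA (N + 1), (∀ i, ⟪v i, x⟫ = 0) →
      extDEval β x v = pbEval F ω x v) (y : EucA N) :
    extDeriv (pb Φ fun x => toCAM b (β x)) y = pb (F ∘ Φ) (fun z => toCAM (b + 1) (ω z)) y := by
  have hB : ContDiff ℝ (⊤ : ℕ∞) fun x => toCAM b (β x) := contDiff_toCAM hβ
  have hBd := hB.differentiable (by simp) (Φ y)
  rw [extDeriv_pb hΦ hB]
  ext v
  rw [pb_apply, extDeriv_apply_eq hBd]
  have h := hβω (Φ y) (h1 y) (fun i => fderiv ℝ Φ y (v i)) fun i => inner_fderiv_eq_zero hΦ h1 y _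
  have hc : ∀ w, fderiv ℝ (F ∘ Φ) y w = fderiv ℝ F (Φ y) (fderiv ℝ Φ y w) := fun w => by
    rw [fderiv_comp _ (hF.differentiable (by simp) _) (hΦ.differentiable (by simp) _)]
    rfl
  rw [pb_apply]
  simp only [hc]
  refine Eq.trans ?_ h
  refine Finset.sum_congr rfl fun i _ => ?_
  rw [← fderiv_continuousAlternatingMap_apply_const_apply hBd]
  rfl

theorem abs_integral_wedge_le {E : Type*} [NormedAddCommGroup E] [InnerProductSpace ℝ E]
    [FiniteDimensional ℝ E] [MeasurableSpace E] [BorelSpace E] {p q : ℕ}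
    {γ : E → E [⋀^Fin p]→L[ℝ] ℝ} {δ : E → E [⋀^Fin q]→L[ℝ] ℝ}
    {A B r s : ℝ} (hA : ∀ y, ‖γ y‖ ≤ A * (1 + ‖y‖) ^ (-r))
    (hB : ∀ y, ‖δ y‖ ≤ B * (1 + ‖y‖) ^ (-s)) (hrs : (Module.finrank ℝ E : ℝ) < r + s)
    {e : Fin (p + q) → E} (he : ∀ i, ‖e i‖ ≤ 1) :
    |∫ y, wedgeEval p q (γ y) (δ y) e| ≤
      (p + q).factorial * (∫ y : E, (1 + ‖y‖) ^ (-(r + s))) * (A * B) := by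
  have hint : Integrable fun y : E => (p + q).factorial * (A * B) * (1 + ‖y‖) ^ (-(r + s)) :=
    (integrable_one_add_norm hrs).const_mul _
  have hle : ∀ y, ‖wedgeEval p q (γ y) (δ y) e‖ ≤
      (p + q).factorial * (A * B) * (1 + ‖y‖) ^ (-(r + s)) := fun y => by
    refine (abs_wedgeEval_le p q (γ y) (δ y) he).trans ?_
    rw [mul_assoc]
    exact mul_le_mul_of_nonneg_left (wedge_decay hA hB y) (by positivity)
  refine (norm_integral_le_of_norm_le hint (Filter.Eventually.of_forall hle)).trans_eq ?_
  rw [integral_const_mul]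
  ring

theorem exists_hopf_bound (b : ℕ) (hb : 1 ≤ b) : ∃ C : ℝ, 0 < C ∧
    ∀ F : EucA (b + (b + 1) + 1) → EucA (b + 1 + 1), ContDiff ℝ (⊤ : ℕ∞) F →
      (∀ x, ‖x‖ = 1 → ‖F x‖ = 1) →
    ∀ D : ℝ, kDilation (b + 1) F ≤ D →
    ∀ ω : EucA (b + 1 + 1) → AlternatingMap ℝ (EucA (b + 1 + 1)) ℝ (Fin (b + 1)),
      (∀ v, ContDiff ℝ (⊤ : ℕ∞) fun y => ω y v) →
      sphereFormIntegral rfl ((b + 1 : ℕ) : ℝ) (fun x v => ω x v) = 1 →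
    ∀ β : EucA (b + (b + 1) + 1) → AlternatingMap ℝ (EucA (b + (b + 1) + 1)) ℝ (Fin b),
      (∀ v, ContDiff ℝ (⊤ : ℕ∞) fun y => β y v) →
      (∀ x, ‖x‖ = 1 → ∀ v : Fin (b + 1) → EucA (b + (b + 1) + 1),
        (∀ i, ⟪v i, x⟫ = 0) → extDEval β x v = pbEval F ω x v) →
      |sphereFormIntegral rfl ((b + (b + 1) : ℕ) : ℝ)
        (fun x => wedgeEval b (b + 1) (fun v => β x v) (fun w => pbEval F ω x w))| ≤
          C * D ^ 2 := by
  obtain ⟨Φ, hΦ, h1, hconf, -⟩ := exists_conformal_chart (b + (b + 1))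
  obtain ⟨c₁, hc₁⟩ := exists_sphereFormIntegral_eq (by omega) hΦ h1 hconf
  obtain ⟨c, -, hc⟩ := exists_integral_wedge_pb_eq b hb
  obtain ⟨s, hs⟩ := exists_stokes (E := EucA (b + (b + 1))) b b
  obtain ⟨ε, hε, hcomm⟩ := wedgeEval_comm (E := EucA (b + (b + 1))) (b + 1) b (by omega)
  set μ := (μH[((b + 1 : ℕ) : ℝ)].restrict (usph (b + 1 + 1))).real univ with hμ
  set I := ∫ y : EucA (b + (b + 1)), (1 + ‖y‖) ^ (-((b : ℝ) + 2 * ((b + 1 : ℕ) : ℝ))) with hI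
  set K : ℝ := (b + (b + 1) : ℕ) ^ (b + 1) * 4 ^ (b + 1) with hK
  have hI0 : 0 ≤ I := integral_nonneg fun y => by positivity
  have hμ0 : 0 ≤ μ := measureReal_nonneg
  have hK0 : 0 ≤ K := by positivity
  set R : ℝ := |c₁| * (|c| / μ) * |s| * (|c| / μ) * ((b + (b + 1)).factorial * I * (K * K)) with hR
  have hR0 : 0 ≤ R := by positivity
  refine ⟨R + 1, by positivity, ?_⟩
  intro F hF hF1 D hD ω hω hω1 β hβ hβω
  have hμne : μ ≠ 0 := by
    intro h0
    have hfin : μH[((b + 1 : ℕ) : ℝ)].restrict (usph (b + 1 + 1)) univ ≠ ⊤ := by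
      rw [Measure.restrict_apply_univ]; exact (hausdorffMeasure_usph_lt_top (b + 1)).ne
    rw [hμ, measureReal_eq_zero_iff hfin, Measure.measure_univ_eq_zero] at h0
    rw [sphereFormIntegral, h0, integral_zero_measure] at hω1
    exact zero_ne_one hω1
  have hkD := kDilation_nonneg (b + 1) F
  set h := F ∘ Φ with hh_def
  have hh : ContDiff ℝ (⊤ : ℕ∞) h := hF.comp hΦ
  have hh1 : ∀ y, ‖h y‖ = 1 := fun y => hF1 _ (h1 y)
  obtain ⟨M, hM⟩ := exists_norm_fderiv_le hF
  have hdec : ∀ y, ‖fderiv ℝ h y‖ ≤ (M * 4) * (1 + ‖y‖) ^ (-2 : ℝ) := by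
    intro y
    rw [hh_def, fderiv_comp _ (hF.differentiable (by simp) _) (hΦ.differentiable (by simp) _),
      mul_assoc]
    refine (ContinuousLinearMap.opNorm_comp_le _ _).trans ?_
    exact mul_le_mul (hM _ (h1 y)) (norm_fderiv_chart_le hconf y) (norm_nonneg _)
      ((norm_nonneg _).trans (hM _ (h1 y)))
  have hωc : ContDiff ℝ (⊤ : ℕ∞) fun z => toCAM (b + 1) (ω z) := contDiff_toCAM hω
  have hβc : ContDiff ℝ (⊤ : ℕ∞) fun z => toCAM b (β z) := contDiff_toCAM hβ
  obtain ⟨Mω, hMω⟩ := (isCompact_sphere (0 : EucA (b + 1 + 1)) 1).exists_bound_of_continuousOn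
    hωc.continuous.continuousOn
  obtain ⟨Mβ, hMβ⟩ := (isCompact_sphere (0 : EucA (b + (b + 1) + 1)) 1
    ).exists_bound_of_continuousOn hβc.continuous.continuousOn
  -- the forms on Euclidean space and their decay
  set V := fun z => volForm (detForm (b + 1 + 1)) z with hV
  have hVs : ContDiff ℝ (⊤ : ℕ∞) V := (volForm (detForm (b + 1 + 1))).contDiff
  set ω' := pb h fun z => toCAM (b + 1) (ω z) with hω'
  set β' := pb Φ fun z => toCAM b (β z) with hβ'
  set A := pb h V with hA
  set T := conePrimitive A with hT
  have hω's : ContDiff ℝ (⊤ : ℕ∞) ω' := contDiff_pb hh hωc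
  have hβ's : ContDiff ℝ (⊤ : ℕ∞) β' := contDiff_pb hΦ hβc
  have hAs : ContDiff ℝ (⊤ : ℕ∞) A := contDiff_pb hh hVs
  have hTs : ContDiff ℝ 1 T := contDiff_conePrimitive hAs
  have hω'd := norm_pb_le_decay hdec (fun z => toCAM (b + 1) (ω z)) (M := Mω)
    fun y => hMω _ (by simpa using hh1 y)
  have hβ'd := norm_pb_le_decay (norm_fderiv_chart_le hconf) (fun z => toCAM b (β z)) (M := Mβ)
    fun y => hMβ _ (by simpa using h1 y)
  have hAd : ∀ y, ‖A y‖ ≤ (K * kDilation (b + 1) F) * (1 + ‖y‖) ^ (-(2 * ((b + 1 : ℕ) : ℝ))) :=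
    norm_pb_volForm_le hΦ h1 hconf hF hF1
  have hTd := norm_conePrimitive_le hAd
  have hMβ0 : 0 ≤ Mβ * 4 ^ b := by simpa using (norm_nonneg _).trans (hβ'd 0)
  have hβ'd' : ∀ y, ‖β' y‖ ≤ Mβ * 4 ^ b * (1 + ‖y‖) ^ (-(b : ℝ)) := fun y =>
    (hβ'd y).trans (mul_le_mul_of_nonneg_left (one_add_norm_rpow_le y (by
      have : (0 : ℝ) ≤ b := by positivity
      linarith)) hMβ0)
  have hdβ : ∀ y, extDeriv β' y = pb h (fun z => toCAM (b + 1) (ω z)) y :=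
    extDeriv_pb_toCAM hΦ h1 hF hβ hβω
  have hcl : ∀ y, extDeriv A y = 0 := fun y => by
    rw [hA, extDeriv_pb hh hVs]
    exact pb_eq_zero hh hh1 (by simp) _ y
  have hdT : ∀ y, extDeriv T y = pb h V y := extDeriv_conePrimitive hAs hcl
  let e : Fin (b + (b + 1)) → EucA (b + (b + 1)) :=
    fun i => EuclideanSpace.basisFun (Fin (b + (b + 1))) ℝ i
  have he : ∀ i, ‖e i‖ ≤ 1 := fun i => by simp [e]
  let e' : Fin (b + 1 + b) → EucA (b + (b + 1)) := fun i => e (Fin.cast (by omega) i)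
  have hb1 : (1 : ℝ) ≤ b := by exact_mod_cast hb
  have hfr : (Module.finrank ℝ (EucA (b + (b + 1))) : ℝ) = 2 * b + 1 := by simp; ring
  -- the chain of identities
  have s1 : sphereFormIntegral rfl ((b + (b + 1) : ℕ) : ℝ)
      (fun x => wedgeEval b (b + 1) (fun v => β x v) (fun w => pbEval F ω x w)) =
      c₁ * ∫ y, wedgeEval b (b + 1) (β' y) (ω' y) e := by
    let ωF : EucA (b + (b + 1) + 1) → AlternatingMap ℝ (EucA (b + (b + 1) + 1)) ℝ (Fin (b + 1)) :=
      fun x => (pb F (fun z => toCAM (b + 1) (ω z)) x).toAlternatingMap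
    have hωF : ContDiff ℝ (⊤ : ℕ∞) (pb F fun z => toCAM (b + 1) (ω z)) := contDiff_pb hF hωc
    have hα := hc₁ (fun x => wedgeAlt b (b + 1) (β x) (ωF x)) (fun v => by
      simp only [wedgeAlt_apply, wedgeEval]
      refine contDiff_const.mul (ContDiff.sum fun σ _ => contDiff_const.mul ((hβ _).mul ?_))
      exact hωF.cam_apply fun _ => contDiff_const)
    simp only [wedgeAlt_apply] at hα
    refine hα.trans ?_
    congr 2
    ext y
    rw [← wedgeEval_comp]
    congr 1
    ext w
    have hcomp : ∀ w, fderiv ℝ h y w = fderiv ℝ F (Φ y) (fderiv ℝ Φ y w) := fun w => by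
      rw [hh_def, fderiv_comp _ (hF.differentiable (by simp) _) (hΦ.differentiable (by simp) _)]
      rfl
    rw [hω', pb_apply]
    simp only [hcomp]
    rfl
  have s2 : μ * ∫ y, wedgeEval b (b + 1) (β' y) (ω' y) e =
      c * 1 * ∫ y, wedgeEval b (b + 1) (β' y) (A y) e := by
    rw [← hω1]
    exact hc hh hh1 hdec (hβ's.of_le (by simp)) hβ'd' hdβ hω
  have s3 : ∫ y, wedgeEval b (b + 1) (β' y) (A y) e =
      s * ∫ y, wedgeEval (b + 1) b (ω' y) (T y) e' := by
    have hst := hs β' T (hβ's.of_le (by simp)) hTs (Mβ * 4 ^ b * (K * kDilation (b + 1) F))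
      (fun y => (wedge_decay hβ'd hTd y).trans (mul_le_mul_of_nonneg_left
        (one_add_norm_rpow_le y (by rw [hfr]; linarith)) (by positivity))) e'
      (by
        simp only [hdβ]
        refine integrable_wedge hω's.continuous hTs.continuous hω'd hTd ?_ fun i => he _
        rw [hfr]; push_cast; linarith)
      (by
        simp only [hdT]
        refine integrable_wedge hβ's.continuous hAs.continuous hβ'd' hAd ?_ fun i => he _
        rw [hfr]; push_cast; linarith)
    simp only [hdT, hdβ] at hst
    exact hst
  have s4 : ∫ y, wedgeEval (b + 1) b (ω' y) (T y) e' =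
      ε * ∫ y, wedgeEval b (b + 1) (T y) (ω' y) e := by
    rw [← integral_const_mul]
    exact integral_congr_ae (Filter.Eventually.of_forall fun y => hcomm _ _ e')
  have s5 : μ * ∫ y, wedgeEval b (b + 1) (T y) (ω' y) e =
      c * 1 * ∫ y, wedgeEval b (b + 1) (T y) (A y) e := by
    rw [← hω1]
    exact hc hh hh1 hdec hTs hTd hdT hω
  have s6 : |∫ y, wedgeEval b (b + 1) (T y) (A y) e| ≤ (b + (b + 1)).factorial * I *
      ((K * kDilation (b + 1) F) * (K * kDilation (b + 1) F)) :=
    abs_integral_wedge_le hTd hAd (by rw [hfr]; push_cast; linarith) he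
  have s2' : ∫ y, wedgeEval b (b + 1) (β' y) (ω' y) e =
      c / μ * ∫ y, wedgeEval b (b + 1) (β' y) (A y) e := by
    field_simp; linarith
  have s5' : ∫ y, wedgeEval b (b + 1) (T y) (ω' y) e =
      c / μ * ∫ y, wedgeEval b (b + 1) (T y) (A y) e := by
    field_simp; linarith
  rw [s1, s2', s3, s4, s5']
  simp only [abs_mul, abs_div, hε, one_mul, abs_of_nonneg hμ0]
  calc _ ≤ |c₁| * (|c| / μ * (|s| * (|c| / μ * ((b + (b + 1)).factorial * I *
      ((K * kDilation (b + 1) F) * (K * kDilation (b + 1) F)))))) := by gcongr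
    _ = R * kDilation (b + 1) F ^ 2 := by rw [hR]; ring
    _ ≤ (R + 1) * D ^ 2 := by gcongr; linarith

end core

theorem abs_sphereFormIntegral_le_of_eq {b m d₁ d₂ : ℕ} {ρ₁ ρ₂ C D : ℝ}
    (h : ∀ F : EucA (b + (b + 1) + 1) → EucA (b + 1 + 1), ContDiff ℝ (⊤ : ℕ∞) F →
      (∀ x, ‖x‖ = 1 → ‖F x‖ = 1) →
    ∀ D : ℝ, kDilation (b + 1) F ≤ D →
    ∀ ω : EucA (b + 1 + 1) → AlternatingMap ℝ (EucA (b + 1 + 1)) ℝ (Fin (b + 1)),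
      (∀ v, ContDiff ℝ (⊤ : ℕ∞) fun y => ω y v) →
      sphereFormIntegral rfl ((b + 1 : ℕ) : ℝ) (fun x v => ω x v) = 1 →
    ∀ β : EucA (b + (b + 1) + 1) → AlternatingMap ℝ (EucA (b + (b + 1) + 1)) ℝ (Fin b),
      (∀ v, ContDiff ℝ (⊤ : ℕ∞) fun y => β y v) →
      (∀ x, ‖x‖ = 1 → ∀ v : Fin (b + 1) → EucA (b + (b + 1) + 1),
        (∀ i, ⟪v i, x⟫ = 0) → extDEval β x v = pbEval F ω x v) →
      |sphereFormIntegral rfl ((b + (b + 1) : ℕ) : ℝ)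
        (fun x => wedgeEval b (b + 1) (fun v => β x v) (fun w => pbEval F ω x w))| ≤ C * D ^ 2)
    (hm : b + 1 = m) (hd₁ : b + m + 1 = d₁) (hd₂ : m + 1 = d₂)
    (hρ₂ : ρ₂ = ((b + 1 : ℕ) : ℝ)) (hρ₁ : ρ₁ = ((b + (b + 1) : ℕ) : ℝ))
    (F : EucA d₁ → EucA d₂) (hF : ContDiff ℝ (⊤ : ℕ∞) F) (hmaps : MapsTo F (usph d₁) (usph d₂))
    (hD : kDilation m F ≤ D) (ω : EucA d₂ → AlternatingMap ℝ (EucA d₂) ℝ (Fin m))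
    (hω : ∀ v, ContDiff ℝ (⊤ : ℕ∞) fun y => ω y v)
    (hω1 : sphereFormIntegral hd₂ ρ₂ (fun x v => ω x v) = 1)
    (β : EucA d₁ → AlternatingMap ℝ (EucA d₁) ℝ (Fin b))
    (hβ : ∀ v, ContDiff ℝ (⊤ : ℕ∞) fun y => β y v)
    (hβω : ∀ x ∈ usph d₁, ∀ v : Fin (b + 1) → EucA d₁,
      (∀ i, ⟪v i, x⟫ = 0) → extDEval β x v = pbEval F ω x (v ∘ Fin.cast hm.symm)) :
    |sphereFormIntegral hd₁ ρ₁
      (fun x => wedgeEval b m (fun v => β x v) (fun w => pbEval F ω x w))| ≤ C * D ^ 2 := by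
  subst hm hd₁ hd₂ hρ₁ hρ₂
  refine h F hF (fun x hx => ?_) D hD ω hω hω1 β hβ fun x hx v hv => ?_
  · simpa [usph] using hmaps (show x ∈ usph _ by simpa [usph] using hx)
  · exact hβω x (by simpa [usph] using hx) v hv

/-- **Gromov's Hopf invariant bound.**  For every `n ≥ 1` there is `C(n) > 0` such that: if
`F : S^{4n-1} → S^{2n}` is a smooth map of `2n`-dilation at most `D`, `ω` is a smooth `2n`-form
on `S^{2n}` with `∫_{S^{2n}} ω = 1`, and `β` is a smooth `(2n-1)`-form on `S^{4n-1}` with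
`dβ = F*ω` (as forms on the sphere, i.e. on tangent vectors at points of the sphere), then
`|∫_{S^{4n-1}} β ∧ F*ω| ≤ C(n) · D²`.  Here `S^{4n-1} = usph (4n) ⊆ ℝ^{4n}`,
`S^{2n} = usph (2n+1) ⊆ ℝ^{2n+1}`; forms on the spheres are represented by (alternating-map
valued) smooth forms on the ambient Euclidean spaces, the degree of `β` being written as `b`
with `b + 1 = 2n`; and the integrals of top-degree forms are with respect to the standard
orientations of the spheres. -/
theorem hopf_integral_le_dilation_sq (n : ℕ) (hn : 1 ≤ n) :
    ∃ C : ℝ, 0 < C ∧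
      ∀ (F : EucA (4 * n) → EucA (2 * n + 1)),
        ContDiff ℝ (⊤ : ℕ∞) F → MapsTo F (usph (4 * n)) (usph (2 * n + 1)) →
      ∀ D : ℝ, kDilation (2 * n) F ≤ D →
      ∀ ω : EucA (2 * n + 1) → AlternatingMap ℝ (EucA (2 * n + 1)) ℝ (Fin (2 * n)),
        (∀ v, ContDiff ℝ (⊤ : ℕ∞) fun y => ω y v) →
        sphereFormIntegral rfl (2 * n : ℝ) (fun x v => ω x v) = 1 →
      ∀ b : ℕ, ∀ hb : b + 1 = 2 * n,
      ∀ β : EucA (4 * n) → AlternatingMap ℝ (EucA (4 * n)) ℝ (Fin b),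
        (∀ v, ContDiff ℝ (⊤ : ℕ∞) fun y => β y v) →
        (∀ x ∈ usph (4 * n), ∀ v : Fin (b + 1) → EucA (4 * n),
          (∀ i, ⟪v i, x⟫ = 0) → extDEval β x v = pbEval F ω x (v ∘ Fin.cast hb.symm)) →
        |sphereFormIntegral (by omega : b + 2 * n + 1 = 4 * n) ((4 * n : ℝ) - 1)
            (fun x => wedgeEval b (2 * n) (fun v => β x v) (fun w => pbEval F ω x w))| ≤
          C * D ^ 2 := by
  obtain ⟨C, hC, h⟩ := exists_hopf_bound (2 * n - 1) (by omega)
  refine ⟨C, hC, ?_⟩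
  intro F hF hmaps D hD ω hω hω1 b hb β hβ hβω
  obtain rfl : b = 2 * n - 1 := by omega
  exact abs_sphereFormIntegral_le_of_eq (D := D) h hb (by omega) rfl
    (by rw [← hb]; push_cast; rw [Nat.cast_sub (by omega)]; push_cast; ring)
    (by push_cast; rw [Nat.cast_sub (by omega)]; push_cast; ring)
    F hF hmaps hD ω hω hω1 β hβ hβω
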